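/- arXiv:1405.6808 — 2 statements merged into one kernel-verified Lean document; each statement's English description precedes it below -/
import Mathlib

section
/- Let m ≥ 2 and let Φ : [0,1]^{m(m−1)/2} → ℝ be a continuous function of the variables w_{ij}, 1 ≤ i < j ≤ m. The following are equivalent: (i) there exist a graphon W, not a.e. constant, and a measurable function h : [0,1] → ℝ, not a.e. 0, such that Φ_W(x_1,…,x_m) = Σ_{i=1}^m h(x_i) for a.e. (x_1,…,x_m) ∈ [0,1]^m; (ii) there exist a non-constant graphon W that is constant on each of the three regions [0,1/2]², (1/2,1]², and ([0,1/2]×(1/2,1]) ∪ ((1/2,1]×[0,1/2]), and a function h : [0,1] → ℝ, not a.e. 0, such that Φ_W(x_1,…,x_m) = Σ_{i=1}^m h(x_i) for all (x_1,…,x_m); (iii) there exist u, v, s ∈ [0,1], not all equal, and a, b ∈ ℝ, not both 0, such that for every subset A ⊆ {1,…,m}, setting w_{ij} := u if i,j ∈ A, w_{ij} := v if i,j ∉ A, and w_{ij} := s otherwise, one has Φ((w_{ij})_{i<j}) = a + b|A|. -/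
open Filter Finset Asymptotics MeasureTheory

/-- `numEdges F` is `e(F)`, the number of edges of `F`. -/
noncomputable def numEdges {m : ℕ} (F : SimpleGraph (Fin m)) : ℕ := Nat.card F.edgeSet

/-- A graphon: a symmetric measurable function `[0,1]² → [0,1]`
(encoded as a function on all of `ℝ × ℝ`). -/
def IsGraphon (W : ℝ → ℝ → ℝ) : Prop :=
  Measurable (Function.uncurry W) ∧ (∀ x y, W x y = W y x) ∧
    ∀ x y, W x y ∈ Set.Icc (0 : ℝ) 1

open Classical in
/-- `Ψ_{F,W}(x₁,…,x_m) = ∏_{ij ∈ E(F)} W(x_i,x_j)`. -/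
noncomputable def psi {m : ℕ} (F : SimpleGraph (Fin m)) (W : ℝ → ℝ → ℝ)
    (x : Fin m → ℝ) : ℝ :=
  ∏ i : Fin m, ∏ j : Fin m, if i < j ∧ F.Adj i j then W (x i) (x j) else 1

/-- `Ψ̃_{F,W}`, the symmetrization of `Ψ_{F,W}` over the `m` coordinates. -/
noncomputable def psiSym {m : ℕ} (F : SimpleGraph (Fin m)) (W : ℝ → ℝ → ℝ)
    (x : Fin m → ℝ) : ℝ :=
  ((m.factorial : ℝ))⁻¹ * ∑ σ : Equiv.Perm (Fin m), psi F W (fun i => x (σ i))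

/-- The unit cube `[0,1]^m`. -/
def unitBox (m : ℕ) : Set (Fin m → ℝ) := Set.univ.pi fun _ => Set.Icc (0 : ℝ) 1

/-- The unit square `[0,1]²`. -/
def unitSquare : Set (ℝ × ℝ) := Set.Icc (0 : ℝ) 1 ×ˢ Set.Icc (0 : ℝ) 1

/-- The graphon property `P^W(F;α₁,…,α_m)`:
`∫_{A₁×⋯×A_m} Ψ_{F,W} = p^(e F) ∏ λ(A_i)` for all pairwise disjoint measurable
`A₁,…,A_m ⊆ [0,1]` with `λ(A_i) = α_i`. -/
def GraphonP {m : ℕ} (F : SimpleGraph (Fin m)) (W : ℝ → ℝ → ℝ) (p : ℝ)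
    (α : Fin m → ℝ) : Prop :=
  ∀ A : Fin m → Set ℝ, (∀ i, MeasurableSet (A i)) → (∀ i, A i ⊆ Set.Icc 0 1) →
    Pairwise (fun i j => Disjoint (A i) (A j)) →
    (∀ i, volume (A i) = ENNReal.ofReal (α i)) →
    ∫ x in Set.univ.pi A, psi F W x = p ^ numEdges F * ∏ i, α i

/-- The graphon property `P̃^W(F;α₁,…,α_m)`: as `GraphonP` but with `Ψ̃_{F,W}`. -/
def GraphonPt {m : ℕ} (F : SimpleGraph (Fin m)) (W : ℝ → ℝ → ℝ) (p : ℝ)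
    (α : Fin m → ℝ) : Prop :=
  ∀ A : Fin m → Set ℝ, (∀ i, MeasurableSet (A i)) → (∀ i, A i ⊆ Set.Icc 0 1) →
    Pairwise (fun i j => Disjoint (A i) (A j)) →
    (∀ i, volume (A i) = ENNReal.ofReal (α i)) →
    ∫ x in Set.univ.pi A, psiSym F W x = p ^ numEdges F * ∏ i, α i


open scoped Topology

section IteratedFilters

variable {α β : Type*}

/-- The iterated product of two filters: `p` holds eventually along it iff
`∀ᶠ a in F, ∀ᶠ b in G, p (a, b)`. -/
def iterProd (F : Filter α) (G : Filter β) : Filter (α × β) :=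
  F.bind fun a => G.map (Prod.mk a)

theorem eventually_iterProd {F : Filter α} {G : Filter β} {p : α × β → Prop} :
    (∀ᶠ z in iterProd F G, p z) ↔ ∀ᶠ a in F, ∀ᶠ b in G, p (a, b) :=
  Iff.rfl

theorem iterProd_neBot {F : Filter α} {G : Filter β} [F.NeBot] [G.NeBot] :
    (iterProd F G).NeBot := by
  refine ⟨fun h => ?_⟩
  have h' : ∀ᶠ z in iterProd F G, False := by rw [h]; exact eventually_bot
  obtain ⟨a, ha⟩ := (eventually_iterProd.1 h').exists
  exact ha.exists.elim fun _ => id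

/-- A function with values in a compact set converges along an iterated product of ultrafilters. -/
theorem exists_tendsto_iterProd {X : Type*} [TopologicalSpace X] {K : Set X} (hK : IsCompact K)
    (U : Ultrafilter α) (V : Ultrafilter β) {f : α × β → X} (hf : ∀ z, f z ∈ K) :
    ∃ w ∈ K, Tendsto f (iterProd (U : Filter α) (V : Filter β)) (𝓝 w) :=
  hK.ultrafilter_le_nhds ((U.bind fun a => V.map (Prod.mk a)).map f)
    (le_principal_iff.2 <| show ∀ᶠ z in iterProd (U : Filter α) (V : Filter β), f z ∈ K from
      Eventually.of_forall hf)

/-- The iterated product of finitely many filters, the quantifier over the first coordinate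
being the outermost one. -/
def iterPi : ∀ {n : ℕ}, (Fin n → Filter α) → Filter (Fin n → α)
  | 0, _ => pure Fin.elim0
  | _ + 1, F => (F 0).bind fun a => (iterPi (Fin.tail F)).map (Fin.cons a)

theorem eventually_iterPi_succ {n : ℕ} {F : Fin (n + 1) → Filter α}
    {p : (Fin (n + 1) → α) → Prop} :
    (∀ᶠ x in iterPi F, p x) ↔
      ∀ᶠ a in F 0, ∀ᶠ x in iterPi (Fin.tail F), p (Fin.cons a x) :=
  Iff.rfl

theorem iterPi_neBot {n : ℕ} (F : Fin n → Filter α) [hF : ∀ i, (F i).NeBot] :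
    (iterPi F).NeBot := by
  induction n with
  | zero => exact pure_neBot
  | succ n ih =>
    have : (iterPi (Fin.tail F)).NeBot := ih (Fin.tail F) (hF := fun i => hF i.succ)
    refine ⟨fun h => ?_⟩
    have h' : ∀ᶠ x in iterPi F, False := by rw [h]; exact eventually_bot
    rw [eventually_iterPi_succ] at h'
    obtain ⟨a, ha⟩ := h'.exists
    exact ha.exists.elim fun _ => id

theorem tendsto_eval_iterPi {n : ℕ} (F : Fin n → Filter α) (i : Fin n) :
    Tendsto (fun x : Fin n → α => x i) (iterPi F) (F i) := by
  induction n with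
  | zero => exact i.elim0
  | succ n ih =>
    intro s hs
    change ∀ᶠ x in iterPi F, x i ∈ s
    rw [eventually_iterPi_succ]
    cases i using Fin.cases with
    | zero =>
      filter_upwards [hs] with a ha
      exact Eventually.of_forall fun x => by simpa using ha
    | succ i =>
      refine Eventually.of_forall fun a => ?_
      simpa using! ih (Fin.tail F) i hs

theorem tendsto_pair_iterPi {n : ℕ} (F : Fin n → Filter α) {i j : Fin n} (hij : i < j) :
    Tendsto (fun x : Fin n → α => (x i, x j)) (iterPi F) (iterProd (F i) (F j)) := by
  induction n with
  | zero => exact i.elim0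
  | succ n ih =>
    intro s hs
    change ∀ᶠ x in iterPi F, (x i, x j) ∈ s
    rw [eventually_iterPi_succ]
    cases j using Fin.cases with
    | zero => exact absurd hij (Fin.not_lt_zero i)
    | succ j =>
      cases i using Fin.cases with
      | zero =>
        filter_upwards [eventually_iterProd.1 hs] with a ha
        simpa using! (tendsto_eval_iterPi (Fin.tail F) j).eventually ha
      | succ i =>
        refine Eventually.of_forall fun a => ?_
        simpa using! ih (Fin.tail F) (Fin.succ_lt_succ_iff.1 hij) hs

theorem iterPi_le_ae [MeasurableSpace α] (μ : Measure α) [SigmaFinite μ] {n : ℕ}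
    (F : Fin n → Filter α) (hF : ∀ i, F i ≤ ae μ) :
    iterPi F ≤ ae (Measure.pi fun _ : Fin n => μ) := by
  induction n with
  | zero =>
    intro s hs
    rw [Measure.pi_of_empty _ Fin.elim0] at hs
    obtain ⟨x, hx⟩ := nonempty_of_mem hs
    exact mem_pure.2 (Subsingleton.elim x Fin.elim0 ▸ hx)
  | succ n ih =>
    intro s hs
    have hmp := (measurePreserving_piFinSuccAbove (fun _ : Fin (n + 1) => μ) 0).symm
    have h := Measure.ae_ae_of_ae_prod (hmp.quasiMeasurePreserving.ae hs)
    change ∀ᶠ x in iterPi F, x ∈ s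
    rw [eventually_iterPi_succ]
    filter_upwards [hF 0 h] with a ha
    filter_upwards [ih (Fin.tail F) (fun i => hF i.succ) ha] with x hx
    simpa using! hx

end IteratedFilters

section Density

variable (μ : Measure ℝ)

/-- The filter of sets whose complement has density zero at `y`, measured along a sequence of
shrinking balls. -/
def densityFilter (y : ℝ) : Filter ℝ where
  sets := {S | Tendsto (fun n : ℕ => μ (Sᶜ ∩ Metric.closedBall y (1 / ((n : ℝ) + 1))) /
    μ (Metric.closedBall y (1 / ((n : ℝ) + 1)))) atTop (𝓝 0)}
  univ_sets := by simp
  sets_of_superset {S T} hS hST := by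
    refine tendsto_of_tendsto_of_tendsto_of_le_of_le tendsto_const_nhds hS
      (fun _ => zero_le) fun n => ?_
    dsimp only
    gcongr
  inter_sets {S T} hS hT := by
    have h := Tendsto.add hS hT
    rw [add_zero] at h
    refine tendsto_of_tendsto_of_tendsto_of_le_of_le tendsto_const_nhds h
      (fun _ => zero_le) fun n => ?_
    dsimp only
    rw [← ENNReal.add_div, Set.compl_inter, Set.union_inter_distrib_right]
    gcongr
    exact measure_union_le _ _

theorem mem_densityFilter {y : ℝ} {S : Set ℝ} :
    S ∈ densityFilter μ y ↔
      Tendsto (fun n : ℕ => μ (Sᶜ ∩ Metric.closedBall y (1 / ((n : ℝ) + 1))) /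
        μ (Metric.closedBall y (1 / ((n : ℝ) + 1)))) atTop (𝓝 0) :=
  Iff.rfl

theorem densityFilter_le_ae (y : ℝ) : densityFilter μ y ≤ ae μ := by
  intro S hS
  have h (n : ℕ) : μ (Sᶜ ∩ Metric.closedBall y (1 / ((n : ℝ) + 1))) = 0 :=
    measure_mono_null Set.inter_subset_left hS
  simp only [mem_densityFilter, h, ENNReal.zero_div, tendsto_const_nhds]

theorem densityFilter_neBot [IsLocallyFiniteMeasure μ] {y : ℝ} (hy : y ∈ μ.support) :
    (densityFilter μ y).NeBot := by
  refine ⟨fun h => ?_⟩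
  have h0 : (∅ : Set ℝ) ∈ densityFilter μ y := by rw [h]; exact mem_bot
  rw [mem_densityFilter] at h0
  have h1 (n : ℕ) : μ (∅ᶜ ∩ Metric.closedBall y (1 / ((n : ℝ) + 1))) /
      μ (Metric.closedBall y (1 / ((n : ℝ) + 1))) = 1 := by
    rw [Set.compl_empty, Set.univ_inter]
    refine ENNReal.div_self ?_ (isCompact_closedBall _ _).measure_lt_top.ne
    exact ((Measure.mem_support_iff_forall y).1 hy _
      (Metric.closedBall_mem_nhds y Nat.one_div_pos_of_nat)).ne'
  simp only [h1] at h0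
  exact one_ne_zero (tendsto_nhds_unique tendsto_const_nhds h0)

theorem ae_mem_densityFilter [IsLocallyFiniteMeasure μ] {S : Set ℝ} (hS : MeasurableSet S) :
    ∀ᵐ y ∂μ, y ∈ S → S ∈ densityFilter μ y := by
  filter_upwards [Besicovitch.ae_tendsto_measure_inter_div_of_measurableSet μ hS.compl]
    with y hy hyS
  rw [Set.indicator_of_notMem (by simpa using hyS)] at hy
  refine hy.comp (tendsto_nhdsWithin_iff.2 ⟨tendsto_one_div_add_atTop_nhds_zero_nat,
    Eventually.of_forall fun n => Set.mem_Ioi.2 Nat.one_div_pos_of_nat⟩)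

theorem measurableSet_section_mem_densityFilter [SFinite μ] {P : Set (ℝ × ℝ)}
    (hP : MeasurableSet P) :
    MeasurableSet {z : ℝ × ℝ | {y | (z.1, y) ∈ P} ∈ densityFilter μ z.2} := by
  simp only [mem_densityFilter]
  refine measurableSet_tendsto _ fun n => ?_
  have hball : MeasurableSet {t : (ℝ × ℝ) × ℝ | dist t.2 t.1.2 ≤ 1 / ((n : ℝ) + 1)} :=
    measurableSet_le (by fun_prop) measurable_const
  refine Measurable.div ?_ ?_
  · have h : Measurable fun t : (ℝ × ℝ) × ℝ => (t.1.1, t.2) := by fun_prop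
    exact measurable_measure_prodMk_left ((h hP.compl).inter hball)
  · exact measurable_measure_prodMk_left hball

/-- A set of positive product measure belongs to an iterated product of two ultrafilters
containing all conull sets. -/
theorem exists_ultrafilter_iterProd_mem [IsFiniteMeasure μ] {P : Set (ℝ × ℝ)}
    (hP : MeasurableSet P) (hpos : (μ.prod μ) P ≠ 0) :
    ∃ U V : Ultrafilter ℝ, (U : Filter ℝ) ≤ ae μ ∧ (V : Filter ℝ) ≤ ae μ ∧
      P ∈ iterProd (U : Filter ℝ) (V : Filter ℝ) := by
  have hdens : ∀ᵐ y ∂μ, ∀ᵐ x ∂μ,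
      (x, y) ∈ P → {y' | (x, y') ∈ P} ∈ densityFilter μ y := by
    refine (Measure.ae_ae_comm (p := fun x y => (x, y) ∈ P →
      {y' | (x, y') ∈ P} ∈ densityFilter μ y) ?_).1 ?_
    · have h := hP.compl.union (measurableSet_section_mem_densityFilter μ hP)
      convert! h using 1
      ext z
      simp [imp_iff_not_or]
    · exact Eventually.of_forall fun x => ae_mem_densityFilter μ (measurable_prodMk_left hP)
  have hfreq : ∃ᶠ y in ae μ, ∃ᶠ x in ae μ, (x, y) ∈ P := by
    intro h
    simp only [not_frequently] at h
    refine hpos (Measure.measure_prod_null hP |>.2 ?_)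
    have h' := (Measure.ae_ae_comm (μ := μ) (ν := μ) (p := fun x y => (x, y) ∉ P) hP.compl).2 h
    filter_upwards [h'] with x hx
    simpa [ae_iff] using! hx
  obtain ⟨y, hy, hdy, hsy⟩ := (hfreq.and_eventually
    (hdens.and (Measure.support_mem_ae (μ := μ)))).exists
  have := densityFilter_neBot μ hsy
  have hX : (ae μ ⊓ 𝓟 {x | (x, y) ∈ P}).NeBot := frequently_mem_iff_neBot.1 hy
  refine ⟨Ultrafilter.of (ae μ ⊓ 𝓟 {x | (x, y) ∈ P}), Ultrafilter.of (densityFilter μ y),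
    (Ultrafilter.of_le _).trans inf_le_left,
    (Ultrafilter.of_le _).trans (densityFilter_le_ae μ y), ?_⟩
  refine Ultrafilter.of_le _ ?_
  filter_upwards [mem_inf_of_left hdy, mem_inf_of_right (mem_principal_self _)] with x hx hxP
  exact Ultrafilter.of_le _ (hx hxP)

end Density

section TwoTypePatterns

variable {m : ℕ} {Φ : ({q : Fin m × Fin m // q.1 < q.2} → ℝ) → ℝ} {W : ℝ → ℝ → ℝ} {h : ℝ → ℝ}

theorem twoType_eq_of_tendsto
    (hΦ : ContinuousOn Φ (Set.univ.pi fun _ => Set.Icc (0 : ℝ) 1)) (hW : IsGraphon W)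
    {μ : Measure ℝ} [SigmaFinite μ]
    (hae : ∀ᵐ x ∂(Measure.pi fun _ : Fin m => μ),
      Φ (fun q => W (x q.1.1) (x q.1.2)) = ∑ i, h (x i))
    {U V : Ultrafilter ℝ} (hU : (U : Filter ℝ) ≤ ae μ) (hV : (V : Filter ℝ) ≤ ae μ)
    {α β u v s : ℝ} (hα : Tendsto h U (𝓝 α)) (hβ : Tendsto h V (𝓝 β))
    (hu : Tendsto (Function.uncurry W) (iterProd U U) (𝓝 u))
    (hv : Tendsto (Function.uncurry W) (iterProd V V) (𝓝 v))
    (hs : Tendsto (Function.uncurry W) (iterProd U V) (𝓝 s)) (A : Finset (Fin m)) :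
    Φ (fun q => if q.1.1 ∈ A then (if q.1.2 ∈ A then u else s)
      else (if q.1.2 ∈ A then s else v)) = m * β + (α - β) * A.card := by
  classical
  -- List the coordinates in `A` first, so that only the iterated limit `s` occurs.
  set f : Fin m → ℕ := fun i => if i ∈ A then 0 else 1 with hf
  set τ := Tuple.sort f
  have hmono : Monotone (f ∘ τ) := Tuple.monotone_sort f
  set F : Fin m → Ultrafilter ℝ := fun k => if τ k ∈ A then U else V with hF
  set K : Filter (Fin m → ℝ) := iterPi fun k => (F k : Filter ℝ)
  have : K.NeBot := iterPi_neBot _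
  have hKae : K ≤ ae (Measure.pi fun _ : Fin m => μ) := by
    refine iterPi_le_ae μ _ fun k => ?_
    simp only [hF]
    split_ifs
    exacts [hU, hV]
  set w : Fin m → Fin m → ℝ := fun i j => if i ∈ A then (if j ∈ A then u else s)
      else (if j ∈ A then s else v) with hw
  have hw_symm (i j) : w i j = w j i := by
    simp only [hw]
    split_ifs <;> rfl
  have hlt {k l : Fin m} (hkl : k < l) :
      Tendsto (fun y : Fin m → ℝ => W (y k) (y l)) K (𝓝 (w (τ k) (τ l))) := by
    suffices H : Tendsto (Function.uncurry W) (iterProd (F k) (F l)) (𝓝 (w (τ k) (τ l))) from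
      H.comp (tendsto_pair_iterPi (fun k => (F k : Filter ℝ)) hkl)
    have hle := hmono hkl.le
    simp only [hf, Function.comp_apply] at hle
    by_cases hk : τ k ∈ A <;> by_cases hl : τ l ∈ A
    · simpa only [hF, hw, if_pos hk, if_pos hl] using hu
    · simpa only [hF, hw, if_pos hk, if_neg hl] using hs
    · rw [if_neg hk, if_pos hl] at hle
      exact absurd hle (by norm_num)
    · simpa only [hF, hw, if_neg hk, if_neg hl] using hv
  have hne {i j : Fin m} (hij : i ≠ j) :
      Tendsto (fun y : Fin m → ℝ => W (y (τ.symm i)) (y (τ.symm j))) K (𝓝 (w i j)) := by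
    rcases lt_or_gt_of_ne (τ.symm.injective.ne hij) with hl | hl
    · have h := hlt hl
      rwa [Equiv.apply_symm_apply, Equiv.apply_symm_apply] at h
    · have h := hlt hl
      rw [Equiv.apply_symm_apply, Equiv.apply_symm_apply] at h
      rw [hw_symm]
      exact h.congr fun y => hW.2.1 _ _
  have hlim : Tendsto (fun y : Fin m → ℝ => Φ fun q => W (y (τ.symm q.1.1)) (y (τ.symm q.1.2)))
      K (𝓝 (Φ fun q => w q.1.1 q.1.2)) := by
    have hT : Tendsto (fun (y : Fin m → ℝ) (q : {q : Fin m × Fin m // q.1 < q.2}) =>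
        W (y (τ.symm q.1.1)) (y (τ.symm q.1.2))) K (𝓝 fun q => w q.1.1 q.1.2) :=
      tendsto_pi_nhds.2 fun q => hne q.2.ne
    have hmem (y : Fin m → ℝ) : (fun q : {q : Fin m × Fin m // q.1 < q.2} =>
        W (y (τ.symm q.1.1)) (y (τ.symm q.1.2))) ∈ Set.univ.pi fun _ => Set.Icc (0 : ℝ) 1 :=
      fun q _ => hW.2.2 _ _
    refine (hΦ _ ?_).tendsto.comp (tendsto_nhdsWithin_iff.2 ⟨hT, Eventually.of_forall hmem⟩)
    exact (isClosed_set_pi fun _ _ => isClosed_Icc).mem_of_tendsto hT (Eventually.of_forall hmem)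
  have hsum : Tendsto (fun y : Fin m → ℝ => ∑ i, h (y (τ.symm i))) K
      (𝓝 (∑ i, if i ∈ A then α else β)) := by
    refine tendsto_finsetSum _ fun i _ => ?_
    suffices H : Tendsto h (F (τ.symm i)) (𝓝 (if i ∈ A then α else β)) from
      H.comp (tendsto_eval_iterPi (fun k => (F k : Filter ℝ)) _)
    simp only [hF, Equiv.apply_symm_apply]
    split_ifs
    exacts [hα, hβ]
  have hperm : ∀ᵐ y ∂(Measure.pi fun _ : Fin m => μ),
      Φ (fun q => W (y (τ.symm q.1.1)) (y (τ.symm q.1.2))) = ∑ i, h (y (τ.symm i)) := by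
    have hmp := measurePreserving_piCongrLeft (α := fun _ : Fin m => ℝ) (fun _ => μ) τ
    filter_upwards [hmp.quasiMeasurePreserving.ae hae] with y hy
    have (i : Fin m) : MeasurableEquiv.piCongrLeft (fun _ : Fin m => ℝ) τ y i = y (τ.symm i) := by
      obtain ⟨k, rfl⟩ := τ.surjective i
      rw [MeasurableEquiv.coe_piCongrLeft, Equiv.piCongrLeft_apply_apply, Equiv.symm_apply_apply]
    simpa only [this] using hy
  have hfinal := tendsto_nhds_unique (hlim.congr' (hKae hperm)) hsum
  refine hfinal.trans ?_
  have : ∀ i, (if i ∈ A then α else β) = β + if i ∈ A then α - β else 0 := fun i => by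
    split_ifs <;> ring
  simp only [this, Finset.sum_add_distrib, Finset.sum_ite_mem, Finset.univ_inter,
    Finset.sum_const, Finset.card_univ, Fintype.card_fin, nsmul_eq_mul]
  ring

/-- If `h` is not a.e. equal to a constant, it has two distinct limits along ultrafilters
containing all conull sets. -/
theorem exists_ultrafilter_tendsto_ne {μ : Measure ℝ} (hh : Measurable h)
    (hne : ∀ c : ℝ, ¬ h =ᵐ[μ] fun _ => c) :
    ∃ (U V : Ultrafilter ℝ) (α β : ℝ), (U : Filter ℝ) ≤ ae μ ∧ (V : Filter ℝ) ≤ ae μ ∧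
      Tendsto h U (𝓝 α) ∧ Tendsto h V (𝓝 β) ∧ α ≠ β := by
  have hex {t : ℝ} (ht : t ∈ (μ.map h).support) :
      ∃ U : Ultrafilter ℝ, (U : Filter ℝ) ≤ ae μ ∧ Tendsto h U (𝓝 t) := by
    have : (ae μ ⊓ comap h (𝓝 t)).NeBot := by
      rw [inf_neBot_iff]
      rintro S hS T ⟨N, hN, hNT⟩
      have hpos := (Measure.mem_support_iff_forall t).1 ht _ (interior_mem_nhds.2 hN)
      rw [Measure.map_apply hh isOpen_interior.measurableSet] at hpos
      by_contra hST
      refine hpos.ne' (measure_mono_null (fun x hx hxS => hST ⟨x, hxS, hNT ?_⟩) hS)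
      exact interior_subset (s := N) hx
    exact ⟨Ultrafilter.of _, (Ultrafilter.of_le _).trans inf_le_left,
      tendsto_iff_comap.2 ((Ultrafilter.of_le _).trans inf_le_right)⟩
  have hsupp : ∀ᵐ x ∂μ, h x ∈ (μ.map h).support :=
    ae_of_ae_map hh.aemeasurable (Measure.support_mem_ae (μ := μ.map h))
  obtain ⟨α, hα, β, hβ, hαβ⟩ : (μ.map h).support.Nontrivial := by
    by_contra hs
    rcases (Set.not_nontrivial_iff.1 hs).eq_empty_or_singleton with he | ⟨c, hc⟩
    · exact hne 0 (hsupp.mono fun x hx => by simp [he] at hx)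
    · exact hne c (hsupp.mono fun x hx => by simpa [hc] using hx)
  obtain ⟨U, hU, hUα⟩ := hex hα
  obtain ⟨V, hV, hVβ⟩ := hex hβ
  exact ⟨U, V, α, β, hU, hV, hUα, hVβ, hαβ⟩

/-- If `W` is not a.e. constant, then some two ultrafilters containing all conull sets see
a nonconstant two-type pattern. -/
theorem exists_ultrafilter_twoType_ne {μ : Measure ℝ} [IsFiniteMeasure μ] (hW : IsGraphon W)
    (hne : ∀ c : ℝ, ¬ Function.uncurry W =ᵐ[μ.prod μ] fun _ => c) :
    ∃ (U V : Ultrafilter ℝ) (u v s : ℝ), (U : Filter ℝ) ≤ ae μ ∧ (V : Filter ℝ) ≤ ae μ ∧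
      Tendsto (Function.uncurry W) (iterProd U U) (𝓝 u) ∧
      Tendsto (Function.uncurry W) (iterProd V V) (𝓝 v) ∧
      Tendsto (Function.uncurry W) (iterProd U V) (𝓝 s) ∧ ¬ (u = v ∧ v = s) := by
  by_contra! H
  have hlim (U V : Ultrafilter ℝ) :=
    exists_tendsto_iterProd isCompact_Icc U V (f := Function.uncurry W) fun z => hW.2.2 z.1 z.2
  choose L _ hL using hlim
  have hμ : μ ≠ 0 := by
    rintro rfl
    exact hne 0 (by simp [EventuallyEq])
  have : (ae μ).NeBot := ae_neBot.2 hμ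
  set U₀ := Ultrafilter.of (ae μ)
  have hconst {U V : Ultrafilter ℝ} (hU : (U : Filter ℝ) ≤ ae μ) (hV : (V : Filter ℝ) ≤ ae μ) :
      L U V = L U₀ U₀ := by
    have h1 := H U V _ _ _ hU hV (hL _ _) (hL _ _) (hL _ _)
    have h2 := H V U₀ _ _ _ hV (Ultrafilter.of_le _) (hL _ _) (hL _ _) (hL _ _)
    exact h1.2.symm.trans h2.1
  refine hne (L U₀ U₀) ?_
  have hball (n : ℕ) : ∀ᵐ z ∂μ.prod μ,
      dist (Function.uncurry W z) (L U₀ U₀) < 1 / ((n : ℝ) + 1) := by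
    by_contra hn
    have hmeas : MeasurableSet
        {z | ¬ dist (Function.uncurry W z) (L U₀ U₀) < 1 / ((n : ℝ) + 1)} :=
      (measurableSet_lt (hW.1.dist measurable_const) measurable_const).compl
    obtain ⟨U, V, hU, hV, hmem⟩ := exists_ultrafilter_iterProd_mem μ hmeas hn
    have hclose : ∀ᶠ z in iterProd (U : Filter ℝ) (V : Filter ℝ),
        dist (Function.uncurry W z) (L U₀ U₀) < 1 / ((n : ℝ) + 1) :=
      Metric.tendsto_nhds.1 (hconst hU hV ▸ hL U V) _ Nat.one_div_pos_of_nat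
    obtain ⟨x, hx⟩ := (eventually_iterProd.1 (hclose.and hmem)).exists
    obtain ⟨y, hy⟩ := hx.exists
    exact hy.2 hy.1
  filter_upwards [ae_all_iff.2 hball] with z hz
  refine dist_le_zero.1 (ge_of_tendsto' tendsto_one_div_add_atTop_nhds_zero_nat fun n => (hz n).le)

end TwoTypePatterns

section Equivalence

variable {m : ℕ} {Φ : ({q : Fin m × Fin m // q.1 < q.2} → ℝ) → ℝ}

/-- The graphon with two types, split at `1/2`. -/
noncomputable def twoTypeGraphon (u v s x y : ℝ) : ℝ :=
  if 1 / 2 < x then (if 1 / 2 < y then u else s) else (if 1 / 2 < y then s else v)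

theorem isGraphon_twoTypeGraphon {u v s : ℝ} (hu : u ∈ Set.Icc (0 : ℝ) 1)
    (hv : v ∈ Set.Icc (0 : ℝ) 1) (hs : s ∈ Set.Icc (0 : ℝ) 1) :
    IsGraphon (twoTypeGraphon u v s) := by
  have hfst : MeasurableSet {z : ℝ × ℝ | 1 / 2 < z.1} :=
    measurableSet_lt measurable_const measurable_fst
  have hsnd : MeasurableSet {z : ℝ × ℝ | 1 / 2 < z.2} :=
    measurableSet_lt measurable_const measurable_snd
  refine ⟨?_, fun x y => ?_, fun x y => ?_⟩
  · exact Measurable.ite hfst (measurable_const.ite hsnd measurable_const)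
      (measurable_const.ite hsnd measurable_const)
  · unfold twoTypeGraphon
    split_ifs <;> rfl
  · unfold twoTypeGraphon
    split_ifs <;> assumption

theorem twoTypeGraphon_eq_sum (hm : m ≠ 0) {u v s a b : ℝ}
    (H : ∀ A : Finset (Fin m),
      Φ (fun q => if q.1.1 ∈ A then (if q.1.2 ∈ A then u else s)
        else (if q.1.2 ∈ A then s else v)) = a + b * A.card) (x : Fin m → ℝ) :
    Φ (fun q => twoTypeGraphon u v s (x q.1.1) (x q.1.2)) =
      ∑ i, if 1 / 2 < x i then a / m + b else a / m := by
  have hm' : (m : ℝ) ≠ 0 := Nat.cast_ne_zero.2 hm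
  have h := H {i | 1 / 2 < x i}
  simp only [Finset.mem_filter_univ] at h
  refine h.trans ?_
  have : ∀ i, (if 1 / 2 < x i then a / m + b else a / m) =
      a / m + if 1 / 2 < x i then b else 0 := fun i => by split_ifs <;> simp
  simp only [this, Finset.sum_add_distrib, ← Finset.sum_filter, Finset.sum_const,
    Finset.card_univ, Fintype.card_fin, nsmul_eq_mul]
  field_simp

/-- The almost everywhere identity forces a two-type pattern. -/
theorem exists_twoType_of_ae
    (hΦ : ContinuousOn Φ (Set.univ.pi fun _ => Set.Icc (0 : ℝ) 1)) (hm : m ≠ 0)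
    {W : ℝ → ℝ → ℝ} {h : ℝ → ℝ} (hW : IsGraphon W) (hh : Measurable h)
    {μ : Measure ℝ} [IsFiniteMeasure μ] (hne : ¬ h =ᵐ[μ] fun _ => (0 : ℝ))
    (hWne : ∀ c : ℝ, ¬ Function.uncurry W =ᵐ[μ.prod μ] fun _ => c)
    (hae : ∀ᵐ x ∂(Measure.pi fun _ : Fin m => μ),
      Φ (fun q => W (x q.1.1) (x q.1.2)) = ∑ i, h (x i)) :
    ∃ u v s : ℝ, u ∈ Set.Icc (0 : ℝ) 1 ∧ v ∈ Set.Icc (0 : ℝ) 1 ∧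
      s ∈ Set.Icc (0 : ℝ) 1 ∧ ¬ (u = v ∧ v = s) ∧
      ∃ a b : ℝ, ¬ (a = 0 ∧ b = 0) ∧
      ∀ A : Finset (Fin m),
        Φ (fun q => if q.1.1 ∈ A then (if q.1.2 ∈ A then u else s)
            else (if q.1.2 ∈ A then s else v)) = a + b * A.card := by
  have hm' : (m : ℝ) ≠ 0 := Nat.cast_ne_zero.2 hm
  have hlim (U V : Ultrafilter ℝ) :=
    exists_tendsto_iterProd isCompact_Icc U V (f := Function.uncurry W) fun z => hW.2.2 z.1 z.2
  have hmem {U V : Ultrafilter ℝ} {w : ℝ}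
      (hw : Tendsto (Function.uncurry W) (iterProd (U : Filter ℝ) (V : Filter ℝ)) (𝓝 w)) :
      w ∈ Set.Icc (0 : ℝ) 1 :=
    have : (iterProd (U : Filter ℝ) (V : Filter ℝ)).NeBot := iterProd_neBot
    isClosed_Icc.mem_of_tendsto hw (Eventually.of_forall fun z => hW.2.2 z.1 z.2)
  by_cases hc : ∃ c : ℝ, h =ᵐ[μ] fun _ => c
  · obtain ⟨c, hc⟩ := hc
    have hc0 : c ≠ 0 := by
      rintro rfl
      exact hne hc
    obtain ⟨U, V, u, v, s, hU, hV, hu, hv, hs, huvs⟩ := exists_ultrafilter_twoType_ne hW hWne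
    exact ⟨u, v, s, hmem hu, hmem hv, hmem hs, huvs, m * c, c - c,
      fun h0 => mul_ne_zero hm' hc0 h0.1,
      twoType_eq_of_tendsto hΦ hW hae hU hV (tendsto_const_nhds.congr' (hU hc.symm))
        (tendsto_const_nhds.congr' (hV hc.symm)) hu hv hs⟩
  · obtain ⟨U, V, α, β, hU, hV, hα, hβ, hαβ⟩ :=
      exists_ultrafilter_tendsto_ne hh (not_exists.1 hc)
    obtain ⟨u, hu01, hu⟩ := hlim U U
    obtain ⟨v, hv01, hv⟩ := hlim V V
    obtain ⟨s, hs01, hs⟩ := hlim U V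
    have key := twoType_eq_of_tendsto hΦ hW hae hU hV hα hβ hu hv hs
    refine ⟨u, v, s, hu01, hv01, hs01, ?_, m * β, α - β, fun h0 => hαβ (sub_eq_zero.1 h0.2), key⟩
    rintro ⟨rfl, rfl⟩
    have h1 := (key ∅).symm.trans (by simpa using key univ)
    simp only [Finset.card_empty, Nat.cast_zero, mul_zero, add_zero, left_eq_add,
      mul_eq_zero, hm', or_false] at h1
    exact hαβ (sub_eq_zero.1 h1)

theorem exists_mem_of_ae_restrict {α : Type*} [MeasurableSpace α] {μ : Measure α} {S T : Set α}
    {p : α → Prop} (h : ∀ᵐ x ∂μ.restrict T, p x) (hS : MeasurableSet S) (hST : S ⊆ T)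
    (hμS : μ S ≠ 0) : ∃ x ∈ S, p x := by
  have : (ae (μ.restrict S)).NeBot := ae_neBot.2 (by simpa using hμS)
  obtain ⟨x, hx, hxS⟩ :=
    ((ae_restrict_of_ae_restrict_of_subset hST h).and (ae_restrict_mem hS)).exists
  exact ⟨x, hxS, hx⟩

theorem not_ae_const_twoTypeGraphon {u v s : ℝ} (huvs : ¬ (u = v ∧ v = s)) (c : ℝ) :
    ¬ (fun z : ℝ × ℝ => twoTypeGraphon u v s z.1 z.2)
      =ᵐ[volume.restrict unitSquare] fun _ => c := by
  intro hc
  have hex {S T : Set ℝ} (hS : MeasurableSet S) (hT : MeasurableSet T)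
      (hS1 : S ⊆ Set.Icc 0 1) (hT1 : T ⊆ Set.Icc 0 1) (hS0 : volume S ≠ 0) (hT0 : volume T ≠ 0) :
      ∃ x ∈ S, ∃ y ∈ T, twoTypeGraphon u v s x y = c := by
    obtain ⟨z, hz, hzc⟩ := exists_mem_of_ae_restrict hc (hS.prod hT) (Set.prod_mono hS1 hT1)
      (by rw [Measure.volume_eq_prod, Measure.prod_prod]; exact mul_ne_zero hS0 hT0)
    exact ⟨z.1, hz.1, z.2, hz.2, hzc⟩
  have hL : Set.Icc (0 : ℝ) (1 / 2) ⊆ Set.Icc 0 1 := Set.Icc_subset_Icc_right (by norm_num)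
  have hR : Set.Ioc (1 / 2 : ℝ) 1 ⊆ Set.Icc 0 1 := fun x hx => ⟨by linarith [hx.1], hx.2⟩
  have hL0 : volume (Set.Icc (0 : ℝ) (1 / 2)) ≠ 0 := by simp
  have hR0 : volume (Set.Ioc (1 / 2 : ℝ) 1) ≠ 0 := by norm_num [Real.volume_Ioc]
  obtain ⟨x₁, hx₁, y₁, hy₁, h₁⟩ := hex measurableSet_Ioc measurableSet_Ioc hR hR hR0 hR0
  obtain ⟨x₂, hx₂, y₂, hy₂, h₂⟩ := hex measurableSet_Icc measurableSet_Icc hL hL hL0 hL0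
  obtain ⟨x₃, hx₃, y₃, hy₃, h₃⟩ := hex measurableSet_Icc measurableSet_Ioc hL hR hL0 hR0
  rw [twoTypeGraphon, if_pos hx₁.1, if_pos hy₁.1] at h₁
  rw [twoTypeGraphon, if_neg hx₂.2.not_gt, if_neg hy₂.2.not_gt] at h₂
  rw [twoTypeGraphon, if_neg hx₃.2.not_gt, if_pos hy₃.1] at h₃
  exact huvs ⟨h₁.trans h₂.symm, h₂.trans h₃.symm⟩

theorem not_ae_zero_ite {a b : ℝ} (hab : ¬ (a = 0 ∧ b = 0)) :
    ¬ (fun x : ℝ => if 1 / 2 < x then a + b else a)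
      =ᵐ[volume.restrict (Set.Icc (0 : ℝ) 1)] fun _ => (0 : ℝ) := by
  intro hc
  obtain ⟨x, hx, h₁⟩ := exists_mem_of_ae_restrict hc (measurableSet_Icc (a := 0) (b := 1 / 2))
    (Set.Icc_subset_Icc_right (by norm_num)) (by simp)
  obtain ⟨y, hy, h₂⟩ := exists_mem_of_ae_restrict hc (measurableSet_Ioc (a := 1 / 2) (b := 1))
    (fun x hx => ⟨by linarith [hx.1], hx.2⟩) (by norm_num [Real.volume_Ioc])
  simp only [if_neg hx.2.not_gt] at h₁
  simp only [if_pos hy.1] at h₂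
  exact hab ⟨h₁, by linarith⟩

/-- A graphon which is constant on the four quarters of the unit square and satisfies the
identity everywhere yields a two-type pattern. -/
theorem exists_twoType_of_forall (hm : m ≠ 0)
    {W : ℝ → ℝ → ℝ} {h : ℝ → ℝ} (hW : IsGraphon W) {u v s : ℝ}
    (hu : ∀ x ∈ Set.Ioc (1/2 : ℝ) 1, ∀ y ∈ Set.Ioc (1/2 : ℝ) 1, W x y = u)
    (hv : ∀ x ∈ Set.Icc (0 : ℝ) (1/2), ∀ y ∈ Set.Icc (0 : ℝ) (1/2), W x y = v)
    (hs : ∀ x ∈ Set.Icc (0 : ℝ) (1/2), ∀ y ∈ Set.Ioc (1/2 : ℝ) 1, W x y = s)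
    (hne : ¬ h =ᵐ[volume.restrict (Set.Icc (0 : ℝ) 1)] fun _ => (0 : ℝ))
    (hWne : ¬ ∃ c : ℝ, ∀ x ∈ Set.Icc (0 : ℝ) 1, ∀ y ∈ Set.Icc (0 : ℝ) 1, W x y = c)
    (H : ∀ x : Fin m → ℝ, (∀ i, x i ∈ Set.Icc (0 : ℝ) 1) →
      Φ (fun q => W (x q.1.1) (x q.1.2)) = ∑ i, h (x i)) :
    ∃ u v s : ℝ, u ∈ Set.Icc (0 : ℝ) 1 ∧ v ∈ Set.Icc (0 : ℝ) 1 ∧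
      s ∈ Set.Icc (0 : ℝ) 1 ∧ ¬ (u = v ∧ v = s) ∧
      ∃ a b : ℝ, ¬ (a = 0 ∧ b = 0) ∧
      ∀ A : Finset (Fin m),
        Φ (fun q => if q.1.1 ∈ A then (if q.1.2 ∈ A then u else s)
            else (if q.1.2 ∈ A then s else v)) = a + b * A.card := by
  have hm' : (m : ℝ) ≠ 0 := Nat.cast_ne_zero.2 hm
  have h0 : (0 : ℝ) ∈ Set.Icc (0 : ℝ) (1 / 2) := by norm_num
  have h1 : (1 : ℝ) ∈ Set.Ioc (1 / 2 : ℝ) 1 := by norm_num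
  have hsplit {x : ℝ} (hx : x ∈ Set.Icc (0 : ℝ) 1) :
      x ∈ Set.Icc (0 : ℝ) (1 / 2) ∨ x ∈ Set.Ioc (1 / 2 : ℝ) 1 :=
    (le_or_gt x (1 / 2)).imp (fun hx' => ⟨hx.1, hx'⟩) fun hx' => ⟨hx', hx.2⟩
  have hdiag {x y : ℝ} (hx : x ∈ Set.Icc (0 : ℝ) 1) (hy : y ∈ Set.Icc (0 : ℝ) 1)
      (hxy : W x x = W y y) : h x = h y := by
    have e := (H (fun _ => x) fun _ => hx).symm.trans
      ((congrArg (fun c => Φ fun _ => c) hxy).trans (H (fun _ => y) fun _ => hy))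
    simpa [hm'] using e
  refine ⟨u, v, s, hu 1 h1 1 h1 ▸ hW.2.2 1 1, hv 0 h0 0 h0 ▸ hW.2.2 0 0,
    hs 0 h0 1 h1 ▸ hW.2.2 0 1, ?_, m * h 0, h 1 - h 0, ?_, fun A => ?_⟩
  · rintro ⟨rfl, rfl⟩
    refine hWne ⟨u, fun x hx y hy => ?_⟩
    rcases hsplit hx with hx | hx <;> rcases hsplit hy with hy | hy
    exacts [hv x hx y hy, hs x hx y hy, hW.2.1 x y ▸ hs y hy x hx, hu x hx y hy]
  · rintro ⟨ha, hb⟩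
    have hh0 : h 0 = 0 := (mul_eq_zero.1 ha).resolve_left hm'
    have hh1 : h 1 = 0 := by linarith
    refine hne ((ae_restrict_mem measurableSet_Icc).mono fun x hx => ?_)
    rcases hsplit hx with hx' | hx'
    · exact (hdiag hx (by norm_num) ((hv x hx' x hx').trans (hv 0 h0 0 h0).symm)).trans hh0
    · exact (hdiag hx (by norm_num) ((hu x hx' x hx').trans (hu 1 h1 1 h1).symm)).trans hh1
  · have e := H (fun i => if i ∈ A then 1 else 0) fun i => by split_ifs <;> norm_num
    have hpat : (fun q : {q : Fin m × Fin m // q.1 < q.2} =>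
        W (if q.1.1 ∈ A then 1 else 0) (if q.1.2 ∈ A then 1 else 0)) =
        fun q => if q.1.1 ∈ A then (if q.1.2 ∈ A then u else s)
          else (if q.1.2 ∈ A then s else v) := by
      ext q
      split_ifs
      exacts [hu 1 h1 1 h1, hW.2.1 1 0 ▸ hs 0 h0 1 h1, hs 0 h0 1 h1, hv 0 h0 0 h0]
    rw [← hpat, e]
    have : ∀ i, h (if i ∈ A then 1 else 0) = h 0 + if i ∈ A then h 1 - h 0 else 0 := fun i => by
      split_ifs <;> ring
    simp only [this, Finset.sum_add_distrib, Finset.sum_ite_mem, Finset.univ_inter,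
      Finset.sum_const, Finset.card_univ, Fintype.card_fin, nsmul_eq_mul]
    ring

end Equivalence

/-- **Theorem (TD).** For continuous `Φ` of the variables `w_{ij}` (`i < j`),
the following are equivalent: (i) some graphon `W`, not a.e. constant, and some
measurable `h`, not a.e. `0`, satisfy `Φ_W(x) = ∑ h(x_i)` a.e.; (ii) likewise with a
non-constant 2-type graphon and the identity holding everywhere on `[0,1]^m`;
(iii) some `u,v,s ∈ [0,1]`, not all equal, and `a,b` not both `0`, satisfy
`Φ((w_{ij})) = a + b|A|` for every `A ⊆ [m]` (with `w_{ij}` as in the 2-type pattern). -/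
theorem stmt13 (m : ℕ) (hm : 2 ≤ m)
    (Φ : ({q : Fin m × Fin m // q.1 < q.2} → ℝ) → ℝ)
    (hΦ : ContinuousOn Φ (Set.univ.pi fun _ => Set.Icc (0 : ℝ) 1)) :
    ((∃ (W : ℝ → ℝ → ℝ) (h : ℝ → ℝ), IsGraphon W ∧ Measurable h ∧
        ¬ (h =ᵐ[volume.restrict (Set.Icc (0 : ℝ) 1)] fun _ => (0 : ℝ)) ∧
        ¬ (∃ c : ℝ, (fun z : ℝ × ℝ => W z.1 z.2)
            =ᵐ[volume.restrict unitSquare] fun _ => c) ∧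
        (∀ᵐ x ∂(volume.restrict (unitBox m)),
          Φ (fun q => W (x q.1.1) (x q.1.2)) = ∑ i, h (x i)))
      ↔ (∃ u v s : ℝ, u ∈ Set.Icc (0 : ℝ) 1 ∧ v ∈ Set.Icc (0 : ℝ) 1 ∧
          s ∈ Set.Icc (0 : ℝ) 1 ∧ ¬ (u = v ∧ v = s) ∧
          ∃ a b : ℝ, ¬ (a = 0 ∧ b = 0) ∧
          ∀ A : Finset (Fin m),
            Φ (fun q => if q.1.1 ∈ A then (if q.1.2 ∈ A then u else s)
                else (if q.1.2 ∈ A then s else v)) = a + b * A.card))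
    ∧ ((∃ (W : ℝ → ℝ → ℝ) (h : ℝ → ℝ), IsGraphon W ∧
        (∃ u v s : ℝ,
          (∀ x ∈ Set.Ioc (1/2 : ℝ) 1, ∀ y ∈ Set.Ioc (1/2 : ℝ) 1, W x y = u) ∧
          (∀ x ∈ Set.Icc (0 : ℝ) (1/2), ∀ y ∈ Set.Icc (0 : ℝ) (1/2), W x y = v) ∧
          (∀ x ∈ Set.Icc (0 : ℝ) (1/2), ∀ y ∈ Set.Ioc (1/2 : ℝ) 1, W x y = s)) ∧
        ¬ (h =ᵐ[volume.restrict (Set.Icc (0 : ℝ) 1)] fun _ => (0 : ℝ)) ∧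
        ¬ (∃ c : ℝ, ∀ x ∈ Set.Icc (0 : ℝ) 1, ∀ y ∈ Set.Icc (0 : ℝ) 1, W x y = c) ∧
        (∀ x : Fin m → ℝ, (∀ i, x i ∈ Set.Icc (0 : ℝ) 1) →
          Φ (fun q => W (x q.1.1) (x q.1.2)) = ∑ i, h (x i)))
      ↔ (∃ u v s : ℝ, u ∈ Set.Icc (0 : ℝ) 1 ∧ v ∈ Set.Icc (0 : ℝ) 1 ∧
          s ∈ Set.Icc (0 : ℝ) 1 ∧ ¬ (u = v ∧ v = s) ∧
          ∃ a b : ℝ, ¬ (a = 0 ∧ b = 0) ∧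
          ∀ A : Finset (Fin m),
            Φ (fun q => if q.1.1 ∈ A then (if q.1.2 ∈ A then u else s)
                else (if q.1.2 ∈ A then s else v)) = a + b * A.card)) := by
  have hm0 : m ≠ 0 := by omega
  have hm' : (m : ℝ) ≠ 0 := Nat.cast_ne_zero.2 hm0
  have hab_div {a b : ℝ} (hab : ¬ (a = 0 ∧ b = 0)) : ¬ (a / m = 0 ∧ b = 0) := fun h =>
    hab ⟨(div_eq_zero_iff.1 h.1).resolve_right hm', h.2⟩
  refine ⟨⟨?_, ?_⟩, ⟨?_, ?_⟩⟩
  · rintro ⟨W, h, hW, hh, hne, hWne, hae⟩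
    rw [unitBox, volume_pi, Measure.restrict_pi_pi] at hae
    rw [unitSquare, Measure.volume_eq_prod, ← Measure.prod_restrict] at hWne
    exact exists_twoType_of_ae hΦ hm0 hW hh hne (not_exists.1 hWne) hae
  · rintro ⟨u, v, s, hu, hv, hs, huvs, a, b, hab, H⟩
    exact ⟨twoTypeGraphon u v s, fun x => if 1 / 2 < x then a / m + b else a / m,
      isGraphon_twoTypeGraphon hu hv hs,
      measurable_const.ite (measurableSet_lt measurable_const measurable_id) measurable_const,
      not_ae_zero_ite (hab_div hab),
      fun ⟨c, hc⟩ => not_ae_const_twoTypeGraphon huvs c hc,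
      Eventually.of_forall (twoTypeGraphon_eq_sum hm0 H)⟩
  · rintro ⟨W, h, hW, ⟨u, v, s, hu, hv, hs⟩, hne, hWne, H⟩
    exact exists_twoType_of_forall hm0 hW hu hv hs hne hWne H
  · rintro ⟨u, v, s, hu, hv, hs, huvs, a, b, hab, H⟩
    refine ⟨twoTypeGraphon u v s, fun x => if 1 / 2 < x then a / m + b else a / m,
      isGraphon_twoTypeGraphon hu hv hs, ⟨u, v, s, fun x hx y hy => ?_, fun x hx y hy => ?_,
        fun x hx y hy => ?_⟩, not_ae_zero_ite (hab_div hab), ?_,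
      fun x _ => twoTypeGraphon_eq_sum hm0 H x⟩
    · rw [twoTypeGraphon, if_pos hx.1, if_pos hy.1]
    · rw [twoTypeGraphon, if_neg hx.2.not_gt, if_neg hy.2.not_gt]
    · rw [twoTypeGraphon, if_neg hx.2.not_gt, if_pos hy.1]
    · rintro ⟨c, hc⟩
      refine not_ae_const_twoTypeGraphon huvs c ?_
      exact (ae_restrict_mem (measurableSet_Icc.prod measurableSet_Icc)).mono
        fun z hz => hc z.1 hz.1 z.2 hz.2
end

section
/- Let α, β > 0 with α + β < 1. Suppose f : [0,1]³ → ℂ is a symmetric integrable function such that ∫_{A×A×B} f = 0 for all disjoint measurable subsets A and B of [0,1] with λ(A) = α and λ(B) = β. Then f = 0 almost everywhere. -/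
open Filter Finset Asymptotics MeasureTheory

lemma eq_of_mem_cells {N i j : ℕ} {x : ℝ}
    (hi : x ∈ Set.Ioc ((i : ℝ) / N) (((i + 1 : ℕ) : ℝ) / N))
    (hj : x ∈ Set.Ioc ((j : ℝ) / N) (((j + 1 : ℕ) : ℝ) / N)) : i = j := by
  have hN : (0 : ℝ) < N := by
    rcases Nat.eq_zero_or_pos N with rfl | h
    · simp at hi
    · exact_mod_cast h
  have key : ∀ a b : ℕ, (a : ℝ) / N < x → x ≤ ((b + 1 : ℕ) : ℝ) / N → a ≤ b := by
    intro a b ha hb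
    have := (div_lt_div_iff_of_pos_right hN).1 (ha.trans_le hb)
    exact Nat.lt_succ_iff.1 (by exact_mod_cast this)
  exact le_antisymm (key _ _ hi.1 hj.2) (key _ _ hj.1 hi.2)

/-- A union of one interval `(c j, d j]` in each cell `(j / N, (j + 1) / N]`. -/
def cellUnion (N : ℕ) (c d : ℕ → ℝ) : Set ℝ := ⋃ j ∈ Finset.range N, Set.Ioc (c j) (d j)

lemma measurableSet_cellUnion (N : ℕ) (c d : ℕ → ℝ) : MeasurableSet (cellUnion N c d) :=
  Finset.measurableSet_biUnion _ fun _ _ => measurableSet_Ioc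

lemma cellUnion_subset {N : ℕ} {c d : ℕ → ℝ} (hc : ∀ j : ℕ, (j : ℝ) / N ≤ c j)
    (hd : ∀ j, d j ≤ ((j + 1 : ℕ) : ℝ) / N) : cellUnion N c d ⊆ Set.Icc 0 1 := by
  intro x hx
  simp only [cellUnion, Set.mem_iUnion, Finset.mem_range] at hx
  obtain ⟨j, hj, hx⟩ := hx
  have hN : (0 : ℝ) < N := by exact_mod_cast (Nat.zero_le j).trans_lt hj
  refine ⟨(by positivity : (0 : ℝ) ≤ j / N).trans ((hc j).trans hx.1.le), hx.2.trans ((hd j).trans ?_)⟩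
  rw [div_le_one hN]
  exact_mod_cast hj

lemma integral_indicator_cellUnion {N : ℕ} {c d : ℕ → ℝ} (hc : ∀ j : ℕ, (j : ℝ) / N ≤ c j)
    (hcd : ∀ j, c j ≤ d j) (hd : ∀ j, d j ≤ ((j + 1 : ℕ) : ℝ) / N) {j : ℕ} (hj : j < N) :
    ∫ x in (j : ℝ) / N..((j + 1 : ℕ) : ℝ) / N, (cellUnion N c d).indicator 1 x = d j - c j := by
  have h1 : ∫ x in (j : ℝ) / N..((j + 1 : ℕ) : ℝ) / N,
      (cellUnion N c d).indicator (1 : ℝ → ℝ) x =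
      ∫ x in (j : ℝ) / N..((j + 1 : ℕ) : ℝ) / N, (Set.Ioc (c j) (d j)).indicator (1 : ℝ → ℝ) x := by
    refine intervalIntegral.integral_congr_ae (ae_of_all _ fun x hx => ?_)
    rw [Set.uIoc_of_le ((hc j).trans ((hcd j).trans (hd j)))] at hx
    have : x ∈ cellUnion N c d ↔ x ∈ Set.Ioc (c j) (d j) := by
      simp only [cellUnion, Set.mem_iUnion, Finset.mem_range]
      refine ⟨fun ⟨i, _, hxi⟩ => ?_, fun h => ⟨j, hj, h⟩⟩
      have : i = j := eq_of_mem_cells (Set.Ioc_subset_Ioc (hc i) (hd i) hxi) hx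
      rwa [← this]
    by_cases hx' : x ∈ Set.Ioc (c j) (d j)
    · rw [Set.indicator_of_mem hx', Set.indicator_of_mem (this.2 hx')]
    · rw [Set.indicator_of_notMem hx', Set.indicator_of_notMem (mt this.1 hx')]
  rw [h1, intervalIntegral.integral_of_le ((hc j).trans ((hcd j).trans (hd j))),
    setIntegral_indicator measurableSet_Ioc,
    Set.inter_eq_self_of_subset_right (Set.Ioc_subset_Ioc (hc j) (hd j))]
  simp [hcd j]

lemma exists_disjoint_sets_cell_integral_eq {u v : ℝ → ℝ} (hu : Measurable u) (hv : Measurable v)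
    (hu0 : ∀ x, 0 ≤ u x) (hv0 : ∀ x, 0 ≤ v x) (huv : ∀ x, u x + v x ≤ 1) (N : ℕ) :
    ∃ A B : Set ℝ, MeasurableSet A ∧ MeasurableSet B ∧ A ⊆ Set.Icc 0 1 ∧ B ⊆ Set.Icc 0 1 ∧
      Disjoint A B ∧
      (∀ j < N, ∫ x in (j : ℝ) / N..((j + 1 : ℕ) : ℝ) / N, (A.indicator 1 x - u x) = 0) ∧
      (∀ j < N, ∫ x in (j : ℝ) / N..((j + 1 : ℕ) : ℝ) / N, (B.indicator 1 x - v x) = 0) := by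
  have hint : ∀ (w : ℝ → ℝ), Measurable w → (∀ x, 0 ≤ w x) → (∀ x, w x ≤ 1) → ∀ a b,
      IntervalIntegrable w volume a b := by
    intro w hw h0 h1 a b
    refine (intervalIntegrable_const (c := (1 : ℝ))).mono_fun hw.aestronglyMeasurable
      (ae_of_all _ fun x => ?_)
    simpa [abs_of_nonneg (h0 x)] using h1 x
  have hui := hint u hu hu0 fun x => by linarith [huv x, hv0 x]
  have hvi := hint v hv hv0 fun x => by linarith [huv x, hu0 x]
  have hlt : ∀ j : ℕ, (j : ℝ) / N ≤ ((j + 1 : ℕ) : ℝ) / N := fun j => by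
    gcongr; simp
  let a : ℕ → ℝ := fun j => j / N
  let b : ℕ → ℝ := fun j => j / N + ∫ x in (j : ℝ) / N..((j + 1 : ℕ) : ℝ) / N, u x
  let c : ℕ → ℝ := fun j => b j + ∫ x in (j : ℝ) / N..((j + 1 : ℕ) : ℝ) / N, v x
  have hab : ∀ j, a j ≤ b j := fun j =>
    le_add_of_nonneg_right (intervalIntegral.integral_nonneg (hlt j) fun x _ => hu0 x)
  have hbc : ∀ j, b j ≤ c j := fun j =>
    le_add_of_nonneg_right (intervalIntegral.integral_nonneg (hlt j) fun x _ => hv0 x)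
  have hc : ∀ j, c j ≤ ((j + 1 : ℕ) : ℝ) / N := fun j => by
    have : ∫ x in (j : ℝ) / N..((j + 1 : ℕ) : ℝ) / N, (u x + v x) ≤
        ∫ x in (j : ℝ) / N..((j + 1 : ℕ) : ℝ) / N, (1 : ℝ) :=
      intervalIntegral.integral_mono (hlt j) ((hui _ _).add (hvi _ _))
        intervalIntegrable_const huv
    rw [intervalIntegral.integral_add (hui _ _) (hvi _ _), intervalIntegral.integral_const,
      smul_eq_mul, mul_one] at this
    simp only [c, b]
    linarith
  have hA := measurableSet_cellUnion N a b
  have hB := measurableSet_cellUnion N b c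
  have hindi : ∀ S : Set ℝ, MeasurableSet S → ∀ s t,
      IntervalIntegrable (S.indicator (1 : ℝ → ℝ)) volume s t := fun S hS =>
    hint _ (measurable_one.indicator hS) (fun x => Set.indicator_nonneg (by simp) x)
      (fun x => Set.indicator_le_self' (by simp) x)
  refine ⟨cellUnion N a b, cellUnion N b c, hA, hB,
    cellUnion_subset (fun _ => le_rfl) fun j => (hbc j).trans (hc j),
    cellUnion_subset hab hc, ?_, fun j hj => ?_, fun j hj => ?_⟩
  · rw [Set.disjoint_left]
    intro x hx hx'
    simp only [cellUnion, Set.mem_iUnion, Finset.mem_range] at hx hx'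
    obtain ⟨i, _, hi⟩ := hx
    obtain ⟨j, _, hj⟩ := hx'
    have : i = j := eq_of_mem_cells (Set.Ioc_subset_Ioc le_rfl ((hbc i).trans (hc i)) hi)
      (Set.Ioc_subset_Ioc (hab j) (hc j) hj)
    subst this
    exact absurd hi.2 (not_le.2 hj.1)
  · rw [intervalIntegral.integral_sub (hindi _ hA _ _) (hui _ _), integral_indicator_cellUnion
      (fun _ => le_rfl) hab (fun j => (hbc j).trans (hc j)) hj]
    simp [b]
  · rw [intervalIntegral.integral_sub (hindi _ hB _ _) (hvi _ _), integral_indicator_cellUnion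
      hab hbc hc hj]
    simp [c]

lemma norm_setIntegral_mul_le_of_cell_integral_eq_zero {h : ℝ → ℝ} (hm : Measurable h)
    (hb : ∀ x, |h x| ≤ 1) {N : ℕ} (hN : 0 < N)
    (h0 : ∀ j < N, ∫ x in (j : ℝ) / N..((j + 1 : ℕ) : ℝ) / N, h x = 0)
    {g : ℝ → ℂ} (hg : Continuous g) {ε : ℝ}
    (hgε : ∀ x y : ℝ, |x - y| ≤ 1 / N → ‖g x - g y‖ ≤ ε) :
    ‖∫ x in Set.Icc 0 1, (h x : ℂ) * g x‖ ≤ ε := by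
  have hN' : (0 : ℝ) < N := by exact_mod_cast hN
  have hhi : ∀ a b, IntervalIntegrable (fun x => (h x : ℂ)) volume a b := fun a b =>
    (intervalIntegrable_const (c := (1 : ℝ))).mono_fun
      (Complex.measurable_ofReal.comp hm).aestronglyMeasurable
      (ae_of_all _ fun x => by simpa using hb x)
  have hi : ∀ a b, IntervalIntegrable (fun x => (h x : ℂ) * g x) volume a b := fun a b =>
    (hhi a b).mul_continuousOn hg.continuousOn
  have hsum := intervalIntegral.sum_integral_adjacent_intervals (μ := volume)
    (f := fun x => (h x : ℂ) * g x) (a := fun k : ℕ => (k : ℝ) / N) (n := N)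
    fun k _ => hi _ _
  simp only [Nat.cast_zero, zero_div, div_self hN'.ne'] at hsum
  rw [integral_Icc_eq_integral_Ioc, ← intervalIntegral.integral_of_le zero_le_one, ← hsum]
  have hlen : ∀ j : ℕ, ((j + 1 : ℕ) : ℝ) / N - j / N = 1 / N := fun j => by
    push_cast; ring
  have hcell : ∀ j ∈ Finset.range N,
      ‖∫ x in (j : ℝ) / N..((j + 1 : ℕ) : ℝ) / N, (h x : ℂ) * g x‖ ≤ ε * (1 / N) := by
    intro j hj
    have hz : ∫ x in (j : ℝ) / N..((j + 1 : ℕ) : ℝ) / N, (h x : ℂ) * g (j / N) = 0 := by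
      rw [intervalIntegral.integral_mul_const, intervalIntegral.integral_ofReal,
        h0 j (Finset.mem_range.1 hj)]
      simp
    rw [← sub_zero (∫ x in (j : ℝ) / N..((j + 1 : ℕ) : ℝ) / N, (h x : ℂ) * g x), ← hz,
      ← intervalIntegral.integral_sub (hi _ _) ((hhi _ _).mul_const _)]
    have hle : (j : ℝ) / N ≤ ((j + 1 : ℕ) : ℝ) / N := by
      have := hlen j
      have : (0 : ℝ) < 1 / N := by positivity
      linarith
    refine (intervalIntegral.norm_integral_le_of_norm_le_const (C := ε) fun x hx => ?_).trans
      (by rw [hlen, abs_of_pos (by positivity)])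
    rw [Set.uIoc_of_le hle] at hx
    rw [← mul_sub, norm_mul, Complex.norm_real, Real.norm_eq_abs]
    have h1 : ‖g x - g (j / N)‖ ≤ ε := hgε _ _ <| by
      rw [abs_of_pos (sub_pos.2 hx.1), ← hlen j]
      linarith [hx.2]
    calc |h x| * ‖g x - g (j / N)‖ ≤ 1 * ε :=
          mul_le_mul (hb x) h1 (norm_nonneg _) zero_le_one
      _ = ε := one_mul ε
  refine (norm_sum_le _ _).trans ((Finset.sum_le_sum hcell).trans ?_)
  rw [Finset.sum_const, Finset.card_range, nsmul_eq_mul]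
  apply le_of_eq
  field_simp

lemma tendsto_setIntegral_mul_of_cell_integral_eq_zero {h : ℕ → ℝ → ℝ}
    (hm : ∀ N, Measurable (h N)) (hb : ∀ N x, |h N x| ≤ 1)
    (h0 : ∀ N, ∀ j < N, ∫ x in (j : ℝ) / N..((j + 1 : ℕ) : ℝ) / N, h N x = 0)
    {G : ℝ → ℂ} (hG : IntegrableOn G (Set.Icc 0 1)) :
    Tendsto (fun N => ∫ x in Set.Icc 0 1, (h N x : ℂ) * G x) atTop (nhds 0) := by
  rw [NormedAddCommGroup.tendsto_atTop]
  intro ε hε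
  obtain ⟨g, hgs, hgG, hgc, hgi⟩ :=
    hG.exists_hasCompactSupport_integral_sub_le (ε := ε / 3) (by positivity)
  obtain ⟨δ, hδ, hgδ⟩ := Metric.uniformContinuous_iff.1
    (hgs.uniformContinuous_of_continuous hgc) (ε / 3) (by positivity)
  obtain ⟨n, hn⟩ := exists_nat_one_div_lt hδ
  refine ⟨n + 1, fun N hN => ?_⟩
  have hbdd : ∀ F : ℝ → ℂ, IntegrableOn F (Set.Icc 0 1) →
      IntegrableOn (fun x => (h N x : ℂ) * F x) (Set.Icc 0 1) := fun F hF =>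
    Integrable.bdd_mul (c := 1) hF (Complex.measurable_ofReal.comp (hm N)).aestronglyMeasurable
      (ae_of_all _ fun x => by simpa using hb N x)
  have h1 : ‖∫ x in Set.Icc 0 1, (h N x : ℂ) * g x‖ ≤ ε / 3 := by
    refine norm_setIntegral_mul_le_of_cell_integral_eq_zero (hm N) (hb N) (by omega) (h0 N) hgc
      fun x y hxy => ?_
    rw [← dist_eq_norm]
    refine (hgδ (lt_of_le_of_lt ?_ hn)).le
    rw [Real.dist_eq]
    refine hxy.trans (one_div_le_one_div_of_le (by positivity) (by exact_mod_cast hN))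
  have h2 : ‖∫ x in Set.Icc 0 1, (h N x : ℂ) * (G x - g x)‖ ≤ ε / 3 := by
    refine (norm_integral_le_of_norm_le (hG.sub hgi).norm (ae_of_all _ fun x => ?_)).trans hgG
    rw [norm_mul, Complex.norm_real, Real.norm_eq_abs]
    exact mul_le_of_le_one_left (norm_nonneg _) (hb N x)
  have h3 : ∫ x in Set.Icc 0 1, (h N x : ℂ) * G x =
      (∫ x in Set.Icc 0 1, (h N x : ℂ) * g x) + ∫ x in Set.Icc 0 1, (h N x : ℂ) * (G x - g x) := by
    rw [← integral_add (hbdd g hgi) (hbdd (fun x => G x - g x) (hG.sub hgi))]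
    simp only [mul_sub, add_sub_cancel]
  rw [sub_zero, h3]
  linarith [norm_add_le (∫ x in Set.Icc 0 1, (h N x : ℂ) * g x)
    (∫ x in Set.Icc 0 1, (h N x : ℂ) * (G x - g x))]

/-- Lebesgue measure on the unit interval. -/
noncomputable abbrev volIcc : Measure ℝ := volume.restrict (Set.Icc 0 1)

lemma abs_indicator_one_le_one (A : Set ℝ) (x : ℝ) : |A.indicator (1 : ℝ → ℝ) x| ≤ 1 := by
  by_cases hx : x ∈ A <;> simp [hx]

lemma abs_indicator_sub_le_one (A : Set ℝ) {x t : ℝ} (h0 : 0 ≤ t) (h1 : t ≤ 1) :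
    |A.indicator 1 x - t| ≤ 1 := by
  rw [abs_le]
  by_cases hx : x ∈ A <;> simp [hx] <;> constructor <;> linarith

lemma volume_eq_ofReal_integral_of_cell_integral_eq {u : ℝ → ℝ} (hu : Measurable u)
    (hu0 : ∀ x, 0 ≤ u x) (hu1 : ∀ x, u x ≤ 1) {A : Set ℝ} (hA : MeasurableSet A)
    (hA1 : A ⊆ Set.Icc 0 1) {N : ℕ} (hN : 0 < N)
    (h : ∀ j < N, ∫ x in (j : ℝ) / N..((j + 1 : ℕ) : ℝ) / N, (A.indicator 1 x - u x) = 0) :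
    volume A = ENNReal.ofReal (∫ x, u x ∂volIcc) := by
  have hb := fun x : ℝ => abs_indicator_sub_le_one (x := x) A (hu0 x) (hu1 x)
  have h1 := norm_setIntegral_mul_le_of_cell_integral_eq_zero
    ((measurable_one.indicator hA).sub hu) hb hN h (g := fun _ => 1) continuous_const (ε := 0)
    (by simp)
  simp only [mul_one] at h1
  rw [norm_le_zero_iff, integral_complex_ofReal, Complex.ofReal_eq_zero] at h1
  have hi1 : Integrable (A.indicator (1 : ℝ → ℝ)) volIcc :=
    (integrable_const (1 : ℝ)).indicator hA
  have hi2 : Integrable u volIcc := (integrable_const (1 : ℝ)).mono' hu.aestronglyMeasurable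
    (ae_of_all _ fun x => by rw [Real.norm_eq_abs, abs_of_nonneg (hu0 x)]; exact hu1 x)
  simp only [Pi.sub_apply] at h1
  rw [integral_sub hi1 hi2, integral_indicator_one hA, sub_eq_zero] at h1
  rw [← h1, ofReal_measureReal, Measure.restrict_apply hA, Set.inter_eq_self_of_subset_left hA1]

/-- The integral of `u(x) v(y) w(z) F(x, y, z)` over the unit cube. -/
noncomputable def tripleIntegral (F : ℝ × ℝ × ℝ → ℂ) (u v w : ℝ → ℝ) : ℂ :=
  ∫ p, ((u p.1 * v p.2.1 * w p.2.2 : ℝ) : ℂ) * F p ∂volIcc.prod (volIcc.prod volIcc)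

lemma integrable_triple {F : ℝ × ℝ × ℝ → ℂ}
    (hF : Integrable F (volIcc.prod (volIcc.prod volIcc))) {u v w : ℝ → ℝ}
    (hu : Measurable u) (hv : Measurable v) (hw : Measurable w) {a b c : ℝ}
    (hua : ∀ x, |u x| ≤ a) (hvb : ∀ x, |v x| ≤ b) (hwc : ∀ x, |w x| ≤ c) :
    Integrable (fun p : ℝ × ℝ × ℝ => ((u p.1 * v p.2.1 * w p.2.2 : ℝ) : ℂ) * F p)
      (volIcc.prod (volIcc.prod volIcc)) := by
  refine Integrable.bdd_mul (c := a * b * c) hF ?_ (ae_of_all _ fun p => ?_)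
  · exact Measurable.aestronglyMeasurable (by fun_prop)
  · have ha := (abs_nonneg _).trans (hua 0)
    have hb := (abs_nonneg _).trans (hvb 0)
    rw [Complex.norm_real, Real.norm_eq_abs, abs_mul, abs_mul]
    gcongr
    exacts [hua _, hvb _, hwc _]

lemma tripleIntegral_add {F : ℝ × ℝ × ℝ → ℂ}
    (hF : Integrable F (volIcc.prod (volIcc.prod volIcc))) {u u' v w : ℝ → ℝ}
    (hu : Measurable u) (hu' : Measurable u') (hv : Measurable v) (hw : Measurable w)
    {a a' b c : ℝ} (hua : ∀ x, |u x| ≤ a) (hua' : ∀ x, |u' x| ≤ a') (hvb : ∀ x, |v x| ≤ b)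
    (hwc : ∀ x, |w x| ≤ c) :
    tripleIntegral F (u + u') v w = tripleIntegral F u v w + tripleIntegral F u' v w := by
  rw [tripleIntegral, tripleIntegral, tripleIntegral,
    ← integral_add (integrable_triple hF hu hv hw hua hvb hwc)
      (integrable_triple hF hu' hv hw hua' hvb hwc)]
  congr 1 with p
  simp only [Pi.add_apply]
  push_cast
  ring

lemma tripleIntegral_smul (F : ℝ × ℝ × ℝ → ℂ) (c : ℝ) (u v w : ℝ → ℝ) :
    tripleIntegral F (c • u) v w = c * tripleIntegral F u v w := by
  rw [tripleIntegral, tripleIntegral, ← integral_const_mul]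
  congr 1 with p
  simp only [Pi.smul_apply, smul_eq_mul]
  push_cast
  ring

lemma tripleIntegral_swap_right {F : ℝ × ℝ × ℝ → ℂ} (hF : ∀ x y z, F (x, y, z) = F (x, z, y))
    (u v w : ℝ → ℝ) : tripleIntegral F u v w = tripleIntegral F u w v := by
  have h : MeasurePreserving ((MeasurableEquiv.refl ℝ).prodCongr
      (MeasurableEquiv.prodComm (α := ℝ) (β := ℝ)))
      (volIcc.prod (volIcc.prod volIcc)) (volIcc.prod (volIcc.prod volIcc)) :=
    (MeasurePreserving.id volIcc).prod Measure.measurePreserving_swap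
  rw [tripleIntegral, ← h.integral_comp', tripleIntegral]
  congr 1 with ⟨x, y, z⟩
  change ((u x * v z * w y : ℝ) : ℂ) * F (x, z, y) = ((u x * w y * v z : ℝ) : ℂ) * F (x, y, z)
  rw [hF x z y]
  push_cast
  ring

lemma tripleIntegral_swap_left {F : ℝ × ℝ × ℝ → ℂ} (hF : ∀ x y z, F (x, y, z) = F (y, x, z))
    (u v w : ℝ → ℝ) : tripleIntegral F u v w = tripleIntegral F v u w := by
  have h : MeasurePreserving (MeasurableEquiv.prodAssoc.symm.trans
      (((MeasurableEquiv.prodComm (α := ℝ) (β := ℝ)).prodCongr (MeasurableEquiv.refl ℝ)).trans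
        MeasurableEquiv.prodAssoc))
      (volIcc.prod (volIcc.prod volIcc)) (volIcc.prod (volIcc.prod volIcc)) :=
    (measurePreserving_prodAssoc volIcc volIcc volIcc).comp
      ((Measure.measurePreserving_swap.prod (MeasurePreserving.id volIcc)).comp
        ((measurePreserving_prodAssoc volIcc volIcc volIcc).symm _))
  rw [tripleIntegral, ← h.integral_comp', tripleIntegral]
  congr 1 with ⟨x, y, z⟩
  change ((u y * v x * w z : ℝ) : ℂ) * F (y, x, z) = ((v x * u y * w z : ℝ) : ℂ) * F (x, y, z)
  rw [hF y x z]
  push_cast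
  ring

lemma tendsto_tripleIntegral_of_cell_integral_eq_zero {F : ℝ × ℝ × ℝ → ℂ}
    (hF : Integrable F (volIcc.prod (volIcc.prod volIcc))) {h p q : ℕ → ℝ → ℝ}
    (hm : ∀ N, Measurable (h N)) (hb : ∀ N x, |h N x| ≤ 1)
    (h0 : ∀ N, ∀ j < N, ∫ x in (j : ℝ) / N..((j + 1 : ℕ) : ℝ) / N, h N x = 0)
    (hp : ∀ N, Measurable (p N)) (hpb : ∀ N x, |p N x| ≤ 1)
    (hq : ∀ N, Measurable (q N)) (hqb : ∀ N x, |q N x| ≤ 1) :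
    Tendsto (fun N => tripleIntegral F (h N) (p N) (q N)) atTop (nhds 0) := by
  have hi := fun N => integrable_triple hF (hm N) (hp N) (hq N) (hb N) (hpb N) (hqb N)
  have heq : ∀ N, tripleIntegral F (h N) (p N) (q N) = ∫ y : ℝ × ℝ, ∫ x : ℝ,
      ((h N x * p N y.1 * q N y.2 : ℝ) : ℂ) * F (x, y) ∂volIcc ∂volIcc.prod volIcc := fun N =>
    integral_prod_symm _ (hi N)
  simp only [heq]
  rw [← integral_zero (ℝ × ℝ) ℂ (μ := volIcc.prod volIcc)]
  refine tendsto_integral_of_dominated_convergence (fun y => ∫ x, ‖F (x, y)‖ ∂volIcc)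
    (fun N => (hi N).integral_prod_right.aestronglyMeasurable) hF.norm.integral_prod_right
    (fun N => ?_) ?_
  · filter_upwards [hF.prod_left_ae] with y hy
    refine norm_integral_le_of_norm_le hy.norm (ae_of_all _ fun x => ?_)
    rw [norm_mul, Complex.norm_real, Real.norm_eq_abs, abs_mul, abs_mul]
    exact mul_le_of_le_one_left (norm_nonneg _) (mul_le_one₀ (mul_le_one₀ (hb N x) (abs_nonneg _)
      (hpb N _)) (abs_nonneg _) (hqb N _))
  · filter_upwards [hF.prod_left_ae] with y hy
    refine squeeze_zero_norm (fun N => ?_)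
      (tendsto_zero_iff_norm_tendsto_zero.1
        (tendsto_setIntegral_mul_of_cell_integral_eq_zero hm hb h0 hy))
    have : ∫ x, ((h N x * p N y.1 * q N y.2 : ℝ) : ℂ) * F (x, y) ∂volIcc =
        ((p N y.1 * q N y.2 : ℝ) : ℂ) * ∫ x, (h N x : ℂ) * F (x, y) ∂volIcc := by
      rw [← integral_const_mul]
      congr 1 with x
      push_cast
      ring
    rw [this, norm_mul, Complex.norm_real, Real.norm_eq_abs, abs_mul]
    exact mul_le_of_le_one_left (norm_nonneg _) (mul_le_one₀ (hpb N _) (abs_nonneg _) (hqb N _))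

lemma tripleIntegral_eq_zero_of_forall_sets {F : ℝ × ℝ × ℝ → ℂ}
    (hF : Integrable F (volIcc.prod (volIcc.prod volIcc)))
    (h12 : ∀ x y z, F (x, y, z) = F (y, x, z)) (h23 : ∀ x y z, F (x, y, z) = F (x, z, y))
    {u v : ℝ → ℝ} (hu : Measurable u) (hv : Measurable v)
    (hu0 : ∀ x, 0 ≤ u x) (hv0 : ∀ x, 0 ≤ v x) (huv : ∀ x, u x + v x ≤ 1)
    (h : ∀ A B : Set ℝ, MeasurableSet A → MeasurableSet B → A ⊆ Set.Icc 0 1 → B ⊆ Set.Icc 0 1 →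
      Disjoint A B → volume A = ENNReal.ofReal (∫ x, u x ∂volIcc) →
      volume B = ENNReal.ofReal (∫ x, v x ∂volIcc) →
      tripleIntegral F (A.indicator 1) (A.indicator 1) (B.indicator 1) = 0) :
    tripleIntegral F u u v = 0 := by
  choose A B hA hB hA1 hB1 hAB hAu hBv using
    exists_disjoint_sets_cell_integral_eq hu hv hu0 hv0 huv
  have hu1 : ∀ x, u x ≤ 1 := fun x => by linarith [hv0 x, huv x]
  have hv1 : ∀ x, v x ≤ 1 := fun x => by linarith [hu0 x, huv x]
  have hub : ∀ x, |u x| ≤ 1 := fun x => by rw [abs_of_nonneg (hu0 x)]; exact hu1 x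
  have hvb : ∀ x, |v x| ≤ 1 := fun x => by rw [abs_of_nonneg (hv0 x)]; exact hv1 x
  have hmA : ∀ N, Measurable ((A N).indicator (1 : ℝ → ℝ)) := fun N =>
    measurable_one.indicator (hA N)
  have hmB : ∀ N, Measurable ((B N).indicator (1 : ℝ → ℝ)) := fun N =>
    measurable_one.indicator (hB N)
  have hbA : ∀ N x, |(A N).indicator (1 : ℝ → ℝ) x| ≤ 1 := fun N =>
    abs_indicator_one_le_one (A N)
  have hbB : ∀ N x, |(B N).indicator (1 : ℝ → ℝ) x| ≤ 1 := fun N =>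
    abs_indicator_one_le_one (B N)
  have hmAu := fun N => (hmA N).sub hu
  have hmBv := fun N => (hmB N).sub hv
  have hbAu : ∀ N x, |((A N).indicator (1 : ℝ → ℝ) - u) x| ≤ 1 := fun N x =>
    abs_indicator_sub_le_one (A N) (hu0 x) (hu1 x)
  have hbBv : ∀ N x, |((B N).indicator (1 : ℝ → ℝ) - v) x| ≤ 1 := fun N x =>
    abs_indicator_sub_le_one (B N) (hv0 x) (hv1 x)
  have hcyc : ∀ a b c, tripleIntegral F a b c = tripleIntegral F c a b := fun a b c => by
    rw [tripleIntegral_swap_right h23, tripleIntegral_swap_left h12]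
  have t1 := tendsto_tripleIntegral_of_cell_integral_eq_zero hF hmAu hbAu hAu hmA hbA hmB hbB
  have t2 := tendsto_tripleIntegral_of_cell_integral_eq_zero hF hmAu hbAu hAu
    (p := fun _ => u) (fun _ => hu) (fun _ => hub) hmB hbB
  have t3 := tendsto_tripleIntegral_of_cell_integral_eq_zero hF hmBv hbBv hBv
    (p := fun _ => u) (fun _ => hu) (fun _ => hub) (q := fun _ => u) (fun _ => hu) (fun _ => hub)
  have hsum := (t1.add t2).add t3
  have hev : ∀ᶠ N in atTop, tripleIntegral F ((A N).indicator 1 - u) ((A N).indicator 1)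
      ((B N).indicator 1) + tripleIntegral F ((A N).indicator 1 - u) u ((B N).indicator 1) +
      tripleIntegral F ((B N).indicator 1 - v) u u = - tripleIntegral F u u v := by
    filter_upwards [eventually_gt_atTop 0] with N hN
    have e0 := h (A N) (B N) (hA N) (hB N) (hA1 N) (hB1 N) (hAB N)
      (volume_eq_ofReal_integral_of_cell_integral_eq hu hu0 hu1 (hA N) (hA1 N) hN (hAu N))
      (volume_eq_ofReal_integral_of_cell_integral_eq hv hv0 hv1 (hB N) (hB1 N) hN (hBv N))
    have e1 := tripleIntegral_add hF (hmAu N) hu (hmA N) (hmB N) (hbAu N) hub (hbA N) (hbB N)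
    have e2 := tripleIntegral_add hF (hmAu N) hu hu (hmB N) (hbAu N) hub hub (hbB N)
    have e3 := tripleIntegral_add hF (hmBv N) hv hu hu (hbBv N) hvb hub hub
    rw [sub_add_cancel] at e1 e2 e3
    rw [tripleIntegral_swap_left h12 u] at e1
    rw [← hcyc u u, ← hcyc u u v] at e3
    linear_combination e0 - e1 - e2 - e3
  have := tendsto_nhds_unique (hsum.congr' hev) tendsto_const_nhds
  simpa using this.symm

lemma trilinear_eq_zero_of_small_perturbations {V : Type*} [AddCommGroup V] [Module ℝ V]
    {φ : V → V → V → ℂ}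
    (hadd : ∀ u u' v w, φ (u + u') v w = φ u v w + φ u' v w)
    (hsmul : ∀ (c : ℝ) u v w, φ (c • u) v w = c * φ u v w)
    (h12 : ∀ u v w, φ u v w = φ v u w) (h23 : ∀ u v w, φ u v w = φ u w v)
    (m : V →ₗ[ℝ] ℝ) {e : V} (he : m e = 1) {α β : ℝ} (hα : α ≠ 0) (hβ : β ≠ 0)
    (h : ∀ a b, m a = 0 → m b = 0 → ∃ ε : ℝ, 0 < ε ∧ ∀ s t : ℝ, |s| ≤ ε → |t| ≤ ε →
      φ (α • e + s • a) (α • e + s • a) (β • e + t • b) = 0) (u v w : V) :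
    φ u v w = 0 := by
  have hadd2 : ∀ u v v' w, φ u (v + v') w = φ u v w + φ u v' w := fun u v v' w => by
    rw [h12, hadd, h12 v, h12 v']
  have hadd3 : ∀ u v w w', φ u v (w + w') = φ u v w + φ u v w' := fun u v w w' => by
    rw [h23, hadd2, h23 u w, h23 u w']
  have hsmul2 : ∀ (c : ℝ) u v w, φ u (c • v) w = c * φ u v w := fun c u v w => by
    rw [h12, hsmul, h12 v]
  have hsmul3 : ∀ (c : ℝ) u v w, φ u v (c • w) = c * φ u v w := fun c u v w => by
    rw [h23, hsmul2, h23 u w]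
  have hα' : (α : ℂ) ≠ 0 := by exact_mod_cast hα
  have hβ' : (β : ℂ) ≠ 0 := by exact_mod_cast hβ
  have key : ∀ a b, m a = 0 → m b = 0 →
      φ e e e = 0 ∧ φ e e b = 0 ∧ φ a e b = 0 ∧ φ a a b = 0 := by
    intro a b ha hb
    obtain ⟨ε, hε, H⟩ := h a b ha hb
    have hε' : (ε : ℂ) ≠ 0 := by exact_mod_cast hε.ne'
    have P : ∀ s t : ℝ, |s| ≤ ε → |t| ≤ ε → (α : ℂ) ^ 2 * β * φ e e e + α ^ 2 * t * φ e e b +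
        2 * α * β * s * φ a e e + 2 * α * s * t * φ a e b + s ^ 2 * β * φ a a e +
        s ^ 2 * t * φ a a b = 0 := by
      intro s t hs ht
      rw [← H s t hs ht]
      simp only [hadd, hadd2, hadd3, hsmul, hsmul2, hsmul3, h12 e a]
      ring
    have h00 : |(0 : ℝ)| ≤ ε := by simpa using hε.le
    have hp : |ε| ≤ ε := (abs_of_pos hε).le
    have hn : |-ε| ≤ ε := by rw [abs_neg]; exact hp
    have e1 := P 0 0 h00 h00
    have e2 := P 0 ε h00 hp
    have e3 := P ε 0 hp h00
    have e4 := P (-ε) 0 hn h00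
    have e5 := P ε ε hp hp
    have e6 := P (-ε) ε hn hp
    push_cast at e1 e2 e3 e4 e5 e6
    have f1 : φ e e e = 0 := by
      have : (α : ℂ) ^ 2 * β * φ e e e = 0 := by linear_combination e1
      simpa [hα', hβ'] using this
    have f2 : φ e e b = 0 := by
      have : (α : ℂ) ^ 2 * ε * φ e e b = 0 := by linear_combination e2 - e1
      simpa [hα', hε'] using this
    refine ⟨f1, f2, ?_, ?_⟩
    · have : (α : ℂ) * ε * ε * φ a e b = 0 := by
        linear_combination (1 / 4 : ℂ) * (e5 - e6) - (1 / 4 : ℂ) * (e3 - e4)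
      simpa [hα', hε'] using this
    · have : (ε : ℂ) ^ 2 * ε * φ a a b = 0 := by
        linear_combination (1 / 2 : ℂ) * (e5 + e6) - (1 / 2 : ℂ) * (e3 + e4) - e2 + e1
      simpa [hε'] using this
  have pol : ∀ a c b, m a = 0 → m c = 0 → m b = 0 → φ a c b = 0 := by
    intro a c b ha hc hb
    have h1 := (key (a + c) b (by simp [ha, hc]) hb).2.2.2
    rw [hadd, hadd2, hadd2, h12 c a] at h1
    linear_combination (1 / 2 : ℂ) * h1 - (1 / 2 : ℂ) * (key a b ha hb).2.2.2 -
      (1 / 2 : ℂ) * (key c b hc hb).2.2.2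
  have dec : ∀ x : V, ∃ a, m a = 0 ∧ x = m x • e + a := fun x =>
    ⟨x - m x • e, by simp [he], by abel⟩
  obtain ⟨a, ha, hu⟩ := dec u
  obtain ⟨b, hb, hv⟩ := dec v
  obtain ⟨c, hc, hw⟩ := dec w
  have g0 := (key a b ha hb).1
  have g1 : ∀ b, m b = 0 → φ e e b = 0 := fun b hb => (key b b hb hb).2.1
  have g2 : ∀ a b, m a = 0 → m b = 0 → φ a e b = 0 := fun a b ha hb => (key a b ha hb).2.2.1
  rw [hu, hv, hw]
  simp only [hadd, hadd2, hadd3, hsmul, hsmul2, hsmul3, g0, g1 c hc, h23 e b e, g1 b hb,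
    h12 e b c, g2 b c hb hc, h12 a e e, h23 e a e, g1 a ha, g2 a c ha hc, h23 a b e, g2 a b ha hb,
    pol a b c ha hb hc]
  simp

/-- The space of bounded measurable functions on the line. -/
def boundedMeasurable : Submodule ℝ (ℝ → ℝ) where
  carrier := {u | Measurable u ∧ ∃ C, ∀ x, |u x| ≤ C}
  add_mem' := by
    rintro u v ⟨hu, C, hC⟩ ⟨hv, D, hD⟩
    exact ⟨hu.add hv, C + D, fun x => (abs_add_le _ _).trans (add_le_add (hC x) (hD x))⟩
  zero_mem' := ⟨measurable_zero, 0, by simp⟩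
  smul_mem' := by
    rintro c _ ⟨hu, C, hC⟩
    refine ⟨hu.const_smul c, |c| * C, fun x => ?_⟩
    rw [Pi.smul_apply, smul_eq_mul, abs_mul]
    exact mul_le_mul_of_nonneg_left (hC x) (abs_nonneg c)

lemma integrable_of_mem_boundedMeasurable {u : ℝ → ℝ} (hu : u ∈ boundedMeasurable) :
    Integrable u volIcc := by
  obtain ⟨hm, C, hC⟩ := hu
  exact (integrable_const C).mono' hm.aestronglyMeasurable (ae_of_all _ hC)

/-- The mean over the unit interval, as a linear functional. -/
noncomputable def meanIcc : boundedMeasurable →ₗ[ℝ] ℝ where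
  toFun u := ∫ x, u.1 x ∂volIcc
  map_add' u v := integral_add (integrable_of_mem_boundedMeasurable u.2)
    (integrable_of_mem_boundedMeasurable v.2)
  map_smul' c _ := integral_const_mul c _

lemma tripleIntegral_eq_zero_of_mem_boundedMeasurable {α β : ℝ} (hα : 0 < α) (hβ : 0 < β)
    (hαβ : α + β < 1) {F : ℝ × ℝ × ℝ → ℂ}
    (hF : Integrable F (volIcc.prod (volIcc.prod volIcc)))
    (h12 : ∀ x y z, F (x, y, z) = F (y, x, z)) (h23 : ∀ x y z, F (x, y, z) = F (x, z, y))
    (h : ∀ A B : Set ℝ, MeasurableSet A → MeasurableSet B → A ⊆ Set.Icc 0 1 → B ⊆ Set.Icc 0 1 →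
      Disjoint A B → volume A = ENNReal.ofReal α → volume B = ENNReal.ofReal β →
      tripleIntegral F (A.indicator 1) (A.indicator 1) (B.indicator 1) = 0)
    {u v w : ℝ → ℝ} (hu : u ∈ boundedMeasurable) (hv : v ∈ boundedMeasurable)
    (hw : w ∈ boundedMeasurable) : tripleIntegral F u v w = 0 := by
  have hone : (1 : ℝ → ℝ) ∈ boundedMeasurable := ⟨measurable_one, 1, by simp⟩
  have hmean : meanIcc ⟨1, hone⟩ = 1 := by simp [meanIcc]
  refine trilinear_eq_zero_of_small_perturbations
    (φ := fun u v w : boundedMeasurable => tripleIntegral F u v w) ?_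
    (fun c u v w => tripleIntegral_smul F c u v w)
    (fun u v w => tripleIntegral_swap_left h12 u v w)
    (fun u v w => tripleIntegral_swap_right h23 u v w) meanIcc hmean hα.ne' hβ.ne' ?_
    ⟨u, hu⟩ ⟨v, hv⟩ ⟨w, hw⟩
  · rintro ⟨u, hu, C₁, h1⟩ ⟨u', hu', C₂, h2⟩ ⟨v, hv, C₃, h3⟩ ⟨w, hw, C₄, h4⟩
    exact tripleIntegral_add hF hu hu' hv hw h1 h2 h3 h4
  · intro a b ha hb
    obtain ⟨C, hC⟩ := a.2.2
    obtain ⟨D, hD⟩ := b.2.2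
    have hC0 := (abs_nonneg _).trans (hC 0)
    have hD0 := (abs_nonneg _).trans (hD 0)
    obtain ⟨r, hr, hrα, hrβ, hr1⟩ : ∃ r : ℝ, 0 < r ∧ r ≤ α ∧ r ≤ β ∧ α + β + 2 * r ≤ 1 :=
      ⟨min (min α β) ((1 - α - β) / 2), by
        simp only [lt_min_iff]; exact ⟨⟨hα, hβ⟩, by linarith⟩,
        (min_le_left _ _).trans (min_le_left _ _), (min_le_left _ _).trans (min_le_right _ _), by
        linarith [min_le_right (min α β) ((1 - α - β) / 2)]⟩
    refine ⟨r / (C + D + 1), by positivity, fun s t hs ht => ?_⟩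
    have hbound : ∀ y z M : ℝ, |y| ≤ r / (C + D + 1) → |z| ≤ M → M ≤ C + D + 1 →
        |y * z| ≤ r := fun y z M hy hz hM => by
      rw [abs_mul]
      calc |y| * |z| ≤ r / (C + D + 1) * (C + D + 1) :=
            mul_le_mul hy (hz.trans hM) (abs_nonneg z) (by positivity)
        _ = r := div_mul_cancel₀ r (by positivity)
    have hsa : ∀ x, |s * a.1 x| ≤ r := fun x => hbound _ _ C hs (hC x) (by linarith)
    have htb : ∀ x, |t * b.1 x| ≤ r := fun x => hbound _ _ D ht (hD x) (by linarith)
    let U : boundedMeasurable := α • ⟨1, hone⟩ + s • a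
    let V : boundedMeasurable := β • ⟨1, hone⟩ + t • b
    have hU : ∀ x, U.1 x = α + s * a.1 x := fun x => by simp [U]
    have hV : ∀ x, V.1 x = β + t * b.1 x := fun x => by simp [V]
    have hUm : ∫ x, U.1 x ∂volIcc = α := by
      change meanIcc U = α
      rw [map_add, map_smul, map_smul, hmean, ha]
      simp
    have hVm : ∫ x, V.1 x ∂volIcc = β := by
      change meanIcc V = β
      rw [map_add, map_smul, map_smul, hmean, hb]
      simp
    refine tripleIntegral_eq_zero_of_forall_sets hF h12 h23 U.2.1 V.2.1 (fun x => ?_)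
      (fun x => ?_) (fun x => ?_) (by rwa [hUm, hVm])
    · rw [hU]; linarith [(abs_le.1 (hsa x)).1]
    · rw [hV]; linarith [(abs_le.1 (htb x)).1]
    · rw [hU, hV]; linarith [(abs_le.1 (hsa x)).2, (abs_le.1 (htb x)).2]

/-- The coordinates of a point of `Fin 3 → ℝ` as a triple. -/
def tripleEquiv : ℝ × ℝ × ℝ → Fin 3 → ℝ := fun p => ![p.1, p.2.1, p.2.2]

lemma measurePreserving_tripleEquiv : MeasurePreserving tripleEquiv
    (volIcc.prod (volIcc.prod volIcc)) (Measure.pi fun _ => volIcc) := by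
  have hm : Measurable tripleEquiv := by
    refine measurable_pi_iff.2 fun i => ?_
    fin_cases i
    exacts [measurable_fst, measurable_snd.fst, measurable_snd.snd]
  refine ⟨hm, (Measure.pi_eq fun s hs => ?_).symm⟩
  have : tripleEquiv ⁻¹' Set.univ.pi s = s 0 ×ˢ (s 1 ×ˢ s 2) := by
    ext p
    simp [tripleEquiv, Fin.forall_fin_succ]
  rw [Measure.map_apply hm (MeasurableSet.univ_pi hs), this, Measure.prod_prod, Measure.prod_prod,
    Fin.prod_univ_three, mul_assoc]

lemma setIntegral_pi_eq_tripleIntegral {f : (Fin 3 → ℝ) → ℂ}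
    (hf : Integrable f (Measure.pi fun _ => volIcc)) {s : Fin 3 → Set ℝ}
    (hs : ∀ i, MeasurableSet (s i)) :
    ∫ x in Set.univ.pi s, f x ∂(Measure.pi fun _ => volIcc) = tripleIntegral (f ∘ tripleEquiv)
      ((s 0).indicator 1) ((s 1).indicator 1) ((s 2).indicator 1) := by
  have hm := MeasurableSet.univ_pi hs
  rw [← integral_indicator hm, ← measurePreserving_tripleEquiv.map_eq,
    integral_map measurePreserving_tripleEquiv.aemeasurable, tripleIntegral]
  · congr 1 with p
    by_cases h0 : p.1 ∈ s 0 <;> by_cases h1 : p.2.1 ∈ s 1 <;> by_cases h2 : p.2.2 ∈ s 2 <;>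
      simp [Set.indicator, tripleEquiv, Fin.forall_fin_succ, h0, h1, h2]
  · rw [measurePreserving_tripleEquiv.map_eq]
    exact (hf.indicator hm).aestronglyMeasurable

lemma ae_eq_zero_of_forall_setIntegral_pi_eq_zero {ι : Type*} [Fintype ι] {X : ι → Type*}
    [∀ i, MeasurableSpace (X i)] {μ : Measure (∀ i, X i)} {f : (∀ i, X i) → ℂ}
    (hf : Integrable f μ)
    (h : ∀ s : ∀ i, Set (X i), (∀ i, MeasurableSet (s i)) → ∫ x in Set.univ.pi s, f x ∂μ = 0) :
    f =ᵐ[μ] 0 := by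
  refine hf.ae_eq_zero_of_forall_setIntegral_eq_zero fun s hs _ => ?_
  have huniv : ∫ x, f x ∂μ = 0 := by
    simpa [Set.pi_univ] using h (fun _ => Set.univ) fun _ => MeasurableSet.univ
  refine MeasurableSpace.induction_on_inter (C := fun s _ => ∫ x in s, f x ∂μ = 0)
    generateFrom_pi.symm isPiSystem_pi (by simp) ?_ (fun t ht ih => ?_)
    (fun g hd hg ih => ?_) s hs
  · rintro _ ⟨s, hs, rfl⟩
    exact h s fun i => hs i trivial
  · rw [← integral_add_compl ht hf] at huniv
    simpa [ih] using huniv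
  · rw [integral_iUnion hg hd hf.integrableOn]
    simp [ih]

/-- **Lemma (LQ).** Let `α, β > 0` with `α + β < 1`. If `f : [0,1]³ → ℂ` is symmetric
and integrable with `∫_{A×A×B} f = 0` for all disjoint measurable `A, B ⊆ [0,1]` with
`λ(A) = α`, `λ(B) = β`, then `f = 0` a.e. -/
theorem stmt18 (α β : ℝ) (hα : 0 < α) (hβ : 0 < β) (hαβ : α + β < 1)
    (f : (Fin 3 → ℝ) → ℂ)
    (hsym : ∀ (σ : Equiv.Perm (Fin 3)) (x : Fin 3 → ℝ), f (fun i => x (σ i)) = f x)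
    (hint : IntegrableOn f (Set.univ.pi fun _ => Set.Icc 0 1))
    (h0 : ∀ A B : Set ℝ, MeasurableSet A → MeasurableSet B →
        A ⊆ Set.Icc 0 1 → B ⊆ Set.Icc 0 1 → Disjoint A B →
        volume A = ENNReal.ofReal α → volume B = ENNReal.ofReal β →
        ∫ x in Set.univ.pi ![A, A, B], f x = 0) :
    f =ᵐ[volume.restrict (Set.univ.pi fun _ : Fin 3 => Set.Icc (0 : ℝ) 1)] 0 := by
  have hpi : volume.restrict (Set.univ.pi fun _ : Fin 3 => Set.Icc (0 : ℝ) 1) =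
      Measure.pi fun _ => volIcc := by
    rw [volume_pi, Measure.restrict_pi_pi]
  rw [IntegrableOn, hpi] at hint
  rw [hpi]
  have hF : Integrable (f ∘ tripleEquiv) (volIcc.prod (volIcc.prod volIcc)) :=
    measurePreserving_tripleEquiv.integrable_comp_of_integrable hint
  have h12 : ∀ x y z, (f ∘ tripleEquiv) (x, y, z) = (f ∘ tripleEquiv) (y, x, z) := fun x y z => by
    rw [Function.comp_apply, Function.comp_apply, ← hsym (Equiv.swap 0 1)]
    congr 1 with i
    fin_cases i <;> rfl
  have h23 : ∀ x y z, (f ∘ tripleEquiv) (x, y, z) = (f ∘ tripleEquiv) (x, z, y) := fun x y z => by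
    rw [Function.comp_apply, Function.comp_apply, ← hsym (Equiv.swap 1 2)]
    congr 1 with i
    fin_cases i <;> rfl
  refine ae_eq_zero_of_forall_setIntegral_pi_eq_zero hint fun s hs => ?_
  have hmem : ∀ i, (s i).indicator (1 : ℝ → ℝ) ∈ boundedMeasurable := fun i =>
    ⟨measurable_one.indicator (hs i), 1, abs_indicator_one_le_one (s i)⟩
  rw [setIntegral_pi_eq_tripleIntegral hint hs]
  refine tripleIntegral_eq_zero_of_mem_boundedMeasurable hα hβ hαβ hF h12 h23
    (fun A B hA hB hA1 hB1 hAB hvA hvB => ?_) (hmem 0) (hmem 1) (hmem 2)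
  have hAAB : ∀ i, MeasurableSet (![A, A, B] i) := by
    simp [Fin.forall_fin_succ, hA, hB]
  have hsub : Set.univ.pi ![A, A, B] ⊆ Set.univ.pi fun _ : Fin 3 => Set.Icc (0 : ℝ) 1 :=
    Set.pi_mono fun i _ => by fin_cases i <;> assumption
  have := setIntegral_pi_eq_tripleIntegral hint hAAB
  rw [← hpi, Measure.restrict_restrict (MeasurableSet.univ_pi hAAB),
    Set.inter_eq_self_of_subset_left hsub, h0 A B hA hB hA1 hB1 hAB hvA hvB] at this
  exact this.symm
end
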